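/- arXiv:1710.03798 — 9 statements merged into one kernel-verified Lean document; each statement's English description precedes it below -/
import Mathlib

section
/- Let ψ : (0,∞) → ℝ^{1×k} be a row-vector-valued function each of whose components is bounded in absolute value by 1, let p ∈ ℝ^{1×k} be a fixed row vector, and suppose that for all s > 0, ψ(s) = p·D(s) + ψ(s+θ1)·H_1(s) + ψ(s+θ2)·H_2(s). Then for all s > 0 the series C(s) = Σ_{i≥0} Σ_{j≥0} D_{i,j}(s)·C_{i,j}(s) converges absolutely and ψ(s) = p·C(s). -/
open scoped ENNReal

/-- The matrix `A_1(s)` of the M/M/k+M two-class system. -/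
noncomputable def A1 (k : ℕ) (l1 m1 m2 : ℝ) (s : ℝ) : Matrix (Fin k) (Fin k) ℝ :=
  Matrix.of fun a b =>
    if (a : ℕ) = (b : ℕ) then
      l1 * (s + ((k : ℝ) - 1 - (a : ℕ)) * m2) /
        (s + (((a : ℕ) : ℝ) + 1) * m1 + ((k : ℝ) - 1 - (a : ℕ)) * m2)
    else if (a : ℕ) + 1 = (b : ℕ) then
      -(l1 * (((k : ℝ) - (b : ℕ)) * m2) /
        (s + ((b : ℕ) : ℝ) * m1 + ((k : ℝ) - (b : ℕ)) * m2))
    else 0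

/-- The matrix `A_2(s)` of the M/M/k+M two-class system. -/
noncomputable def A2 (k : ℕ) (l2 m1 m2 : ℝ) (s : ℝ) : Matrix (Fin k) (Fin k) ℝ :=
  Matrix.of fun a b =>
    if (a : ℕ) = (b : ℕ) then
      l2 * (s + ((a : ℕ) : ℝ) * m1) /
        (s + ((a : ℕ) : ℝ) * m1 + ((k : ℝ) - (a : ℕ)) * m2)
    else if (a : ℕ) = (b : ℕ) + 1 then
      -(l2 * ((a : ℕ) : ℝ) * m1 /
        (s + ((a : ℕ) : ℝ) * m1 + ((k : ℝ) - (a : ℕ)) * m2))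
    else 0

/-- `H_1(s) = A_1(s)/s`. -/
noncomputable def H1mat (k : ℕ) (l1 m1 m2 : ℝ) (s : ℝ) : Matrix (Fin k) (Fin k) ℝ :=
  s⁻¹ • A1 k l1 m1 m2 s

/-- `H_2(s) = A_2(s)/s`. -/
noncomputable def H2mat (k : ℕ) (l2 m1 m2 : ℝ) (s : ℝ) : Matrix (Fin k) (Fin k) ℝ :=
  s⁻¹ • A2 k l2 m1 m2 s

/-- `D(s) = I + B/s`. -/
noncomputable def Dmat (k : ℕ) (B : Matrix (Fin k) (Fin k) ℝ) (s : ℝ) :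
    Matrix (Fin k) (Fin k) ℝ :=
  1 + s⁻¹ • B

namespace PsiAux

open Finset Matrix

/-- Sum of absolute values of the entries. -/
noncomputable def nm {k : ℕ} (M : Matrix (Fin k) (Fin k) ℝ) : ℝ := ∑ a, ∑ b, |M a b|

lemma nm_nonneg {k : ℕ} (M : Matrix (Fin k) (Fin k) ℝ) : 0 ≤ nm M :=
  Finset.sum_nonneg fun _ _ => Finset.sum_nonneg fun _ _ => abs_nonneg _

lemma nm_zero {k : ℕ} : nm (0 : Matrix (Fin k) (Fin k) ℝ) = 0 := by simp [nm]

lemma nm_add {k : ℕ} (M N : Matrix (Fin k) (Fin k) ℝ) : nm (M + N) ≤ nm M + nm N := by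
  unfold nm
  simp only [← Finset.sum_add_distrib]
  exact Finset.sum_le_sum fun a _ => Finset.sum_le_sum fun b _ => abs_add_le _ _

lemma nm_smul {k : ℕ} (c : ℝ) (M : Matrix (Fin k) (Fin k) ℝ) : nm (c • M) = |c| * nm M := by
  simp [nm, abs_mul, Finset.mul_sum]

lemma row_le {k : ℕ} (M : Matrix (Fin k) (Fin k) ℝ) (a : Fin k) : ∑ b, |M a b| ≤ nm M :=
  Finset.single_le_sum (f := fun a => ∑ b, |M a b|)
    (fun _ _ => Finset.sum_nonneg fun _ _ => abs_nonneg _) (Finset.mem_univ a)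

lemma entry_le {k : ℕ} (M : Matrix (Fin k) (Fin k) ℝ) (a b : Fin k) : |M a b| ≤ nm M :=
  (Finset.single_le_sum (f := fun b => |M a b|)
    (fun _ _ => abs_nonneg _) (Finset.mem_univ b)).trans (row_le M a)

lemma nm_mul {k : ℕ} (M N : Matrix (Fin k) (Fin k) ℝ) : nm (M * N) ≤ nm M * nm N := by
  have h1 : ∀ a, ∑ b, |(M * N) a b| ≤ ∑ c, |M a c| * nm N := by
    intro a
    calc ∑ b, |(M * N) a b| ≤ ∑ b, ∑ c, |M a c| * |N c b| := by
          refine Finset.sum_le_sum fun b _ => ?_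
          rw [Matrix.mul_apply]
          refine (Finset.abs_sum_le_sum_abs _ _).trans (le_of_eq ?_)
          simp [abs_mul]
      _ = ∑ c, |M a c| * ∑ b, |N c b| := by
          rw [Finset.sum_comm]; simp [Finset.mul_sum]
      _ ≤ _ := Finset.sum_le_sum fun c _ =>
          mul_le_mul_of_nonneg_left (row_le N c) (abs_nonneg _)
  unfold nm at *
  rw [Finset.sum_mul]
  refine Finset.sum_le_sum fun a _ => (h1 a).trans (le_of_eq ?_)
  rw [Finset.sum_mul]

lemma nm_le {k : ℕ} (M : Matrix (Fin k) (Fin k) ℝ) (K : ℝ) (h : ∀ a b, |M a b| ≤ K) :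
    nm M ≤ k * (k * K) := by
  unfold nm
  calc ∑ a, ∑ b, |M a b| ≤ ∑ _a : Fin k, ∑ _b : Fin k, K :=
        Finset.sum_le_sum fun a _ => Finset.sum_le_sum fun b _ => h a b
    _ = _ := by simp

lemma frac_bd (l u v : ℝ) (hl : 0 < l) (hu : 0 ≤ u) (huv : u ≤ v) (hv : 0 < v) :
    |l * u / v| ≤ l := by
  rw [abs_of_nonneg (by positivity), div_le_iff₀ hv]
  exact mul_le_mul_of_nonneg_left huv hl.le

lemma cast_bd {k : ℕ} (a : Fin k) : ((a : ℕ) : ℝ) + 1 ≤ k := by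
  exact_mod_cast a.2

lemma nm_A1 (k : ℕ) (l m1 m2 s : ℝ) (hl : 0 < l) (hm1 : 0 < m1) (hm2 : 0 < m2) (hs : 0 < s) :
    nm (A1 k l m1 m2 s) ≤ k * (k * l) := by
  apply nm_le
  intro a b
  have ha := cast_bd a
  have hb := cast_bd b
  simp only [A1, Matrix.of_apply]
  have ha0 : (0 : ℝ) ≤ ((a : ℕ) : ℝ) := Nat.cast_nonneg _
  have hb0 : (0 : ℝ) ≤ ((b : ℕ) : ℝ) := Nat.cast_nonneg _
  have x1 : 0 ≤ ((k : ℝ) - 1 - (a : ℕ)) * m2 := mul_nonneg (by linarith) hm2.le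
  have x2 : 0 ≤ ((k : ℝ) - (b : ℕ)) * m2 := mul_nonneg (by linarith) hm2.le
  have x3 : 0 ≤ (((a : ℕ) : ℝ) + 1) * m1 := by positivity
  have x4 : 0 ≤ ((b : ℕ) : ℝ) * m1 := by positivity
  split_ifs
  · exact frac_bd _ _ _ hl (by linarith) (by linarith) (by linarith)
  · rw [abs_neg]
    exact frac_bd _ _ _ hl (by linarith) (by linarith) (by linarith)
  · simpa using hl.le

lemma nm_A2 (k : ℕ) (l m1 m2 s : ℝ) (hl : 0 < l) (hm1 : 0 < m1) (hm2 : 0 < m2) (hs : 0 < s) :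
    nm (A2 k l m1 m2 s) ≤ k * (k * l) := by
  apply nm_le
  intro a b
  have ha := cast_bd a
  simp only [A2, Matrix.of_apply]
  have x1 : 0 ≤ ((k : ℝ) - (a : ℕ)) * m2 := mul_nonneg (by linarith) hm2.le
  have x3 : 0 ≤ ((a : ℕ) : ℝ) * m1 := by positivity
  split_ifs
  · exact frac_bd _ _ _ hl (by linarith) (by linarith) (by linarith)
  · rw [abs_neg, mul_assoc]
    exact frac_bd _ _ _ hl (by linarith) (by linarith) (by linarith)
  · simpa using hl.le

/-- Shift in the first index. -/
def g1 {M : Type*} [Zero M] (X : ℕ × ℕ → M) (q : ℕ × ℕ) : M :=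
  if q.1 = 0 then 0 else X (q.1 - 1, q.2)

/-- Shift in the second index. -/
def g2 {M : Type*} [Zero M] (X : ℕ × ℕ → M) (q : ℕ × ℕ) : M :=
  if q.2 = 0 then 0 else X (q.1, q.2 - 1)

lemma sum_shift {M : Type*} [AddCommMonoid M] (X Y : ℕ × ℕ → M) (n : ℕ) :
    ∑ q ∈ antidiagonal (n + 1), (g1 X q + g2 Y q) = ∑ q ∈ antidiagonal n, (X q + Y q) := by
  rw [Finset.sum_add_distrib, Finset.sum_add_distrib]
  congr 1
  · rw [Finset.Nat.sum_antidiagonal_succ]; simp [g1]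
  · rw [Finset.Nat.sum_antidiagonal_succ']; simp [g2]

lemma summable_layers (f : ℕ × ℕ → ℝ) (hf : ∀ q, 0 ≤ f q)
    (h : Summable fun n => ∑ q ∈ antidiagonal n, f q) : Summable f := by
  rw [← (Finset.HasAntidiagonal.sigmaAntidiagonalEquivProd (A := ℕ)).summable_iff]
  refine (summable_sigma_of_nonneg (fun _ => hf _)).2 ?_
  refine ⟨fun n => (hasSum_fintype _).summable, ?_⟩
  refine h.congr fun n => ?_
  rw [tsum_fintype]
  exact (Finset.sum_coe_sort (antidiagonal n) f).symm

lemma hasSum_layers {E : Type*} [AddCommMonoid E] [TopologicalSpace E] [ContinuousAdd E]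
    [RegularSpace E] (f : ℕ × ℕ → E) (a : E)
    (h : HasSum f a) : HasSum (fun n => ∑ q ∈ antidiagonal n, f q) a := by
  rw [← (Finset.HasAntidiagonal.sigmaAntidiagonalEquivProd (A := ℕ)).hasSum_iff] at h
  refine h.sigma fun n => ?_
  have := hasSum_fintype (fun q : antidiagonal n => f q)
  rwa [Finset.sum_coe_sort (antidiagonal n) f] at this

end PsiAux

open Matrix in
/-- If the row-vector valued function `ψ` has entries bounded by 1 and satisfies
`ψ(s) = p·D(s) + ψ(s+θ1)·H_1(s) + ψ(s+θ2)·H_2(s)` for all `s > 0`, then for all `s > 0`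
the series `C(s) = Σ_{i,j≥0} D_{i,j}(s)·C_{i,j}(s)` converges absolutely and
`ψ(s) = p·C(s)`. -/
theorem psi_eq_p_mul_C
    (k : ℕ) (hk : 1 ≤ k) (l1 l2 m1 m2 t1 t2 : ℝ)
    (hl1 : 0 < l1) (hl2 : 0 < l2) (hm1 : 0 < m1) (hm2 : 0 < m2)
    (ht1 : 0 < t1) (ht2 : 0 < t2)
    (B : Matrix (Fin k) (Fin k) ℝ)
    (C : ℤ → ℤ → ℝ → Matrix (Fin k) (Fin k) ℝ)
    (hC00 : ∀ s : ℝ, C 0 0 s = 1)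
    (hCneg : ∀ (i j : ℤ) (s : ℝ), i < 0 ∨ j < 0 → C i j s = 0)
    (hCrec : ∀ (i j : ℤ), 0 ≤ i → 0 ≤ j → 0 < i + j → ∀ s : ℝ,
      C i j s =
        H1mat k l1 m1 m2 (s + ((i : ℝ) - 1) * t1 + (j : ℝ) * t2) * C (i - 1) j s
          + H2mat k l2 m1 m2 (s + (i : ℝ) * t1 + ((j : ℝ) - 1) * t2) * C i (j - 1) s)
    (ψ : ℝ → (Fin k → ℝ)) (p : Fin k → ℝ)
    (hbd : ∀ s : ℝ, 0 < s → ∀ a : Fin k, |ψ s a| ≤ 1)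
    (heq : ∀ s : ℝ, 0 < s →
      ψ s = p ᵥ* Dmat k B s + (ψ (s + t1)) ᵥ* H1mat k l1 m1 m2 s
              + (ψ (s + t2)) ᵥ* H2mat k l2 m1 m2 s) :
    ∀ s : ℝ, 0 < s →
      (∀ a b : Fin k, Summable (fun q : ℕ × ℕ =>
        |(Dmat k B (s + (q.1 : ℝ) * t1 + (q.2 : ℝ) * t2) * C (q.1 : ℤ) (q.2 : ℤ) s) a b|)) ∧
      ψ s = p ᵥ* (∑' q : ℕ × ℕ,
        Dmat k B (s + (q.1 : ℝ) * t1 + (q.2 : ℝ) * t2) * C (q.1 : ℤ) (q.2 : ℤ) s) := by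
  intro s hs
  classical
  set σ : ℕ × ℕ → ℝ := fun q => s + (q.1 : ℝ) * t1 + (q.2 : ℝ) * t2 with hσ
  set c : ℕ × ℕ → Matrix (Fin k) (Fin k) ℝ := fun q => C (q.1 : ℤ) (q.2 : ℤ) s with hc
  set h1 : ℕ × ℕ → Matrix (Fin k) (Fin k) ℝ := fun q => H1mat k l1 m1 m2 (σ q) with hh1
  set h2 : ℕ × ℕ → Matrix (Fin k) (Fin k) ℝ := fun q => H2mat k l2 m1 m2 (σ q) with hh2
  obtain ⟨t, ht, htt1, htt2⟩ : ∃ t : ℝ, 0 < t ∧ t ≤ t1 ∧ t ≤ t2 :=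
    ⟨min t1 t2, lt_min ht1 ht2, min_le_left _ _, min_le_right _ _⟩
  have hσs : ∀ q, s ≤ σ q := fun q => by
    have : 0 ≤ (q.1 : ℝ) * t1 := by positivity
    have : 0 ≤ (q.2 : ℝ) * t2 := by positivity
    simp only [hσ]; linarith
  have hσ0 : ∀ q, 0 < σ q := fun q => hs.trans_le (hσs q)
  have hσn : ∀ n : ℕ, ∀ q ∈ Finset.HasAntidiagonal.antidiagonal n, s + n * t ≤ σ q := by
    intro n q hq
    rw [Finset.HasAntidiagonal.mem_antidiagonal] at hq
    have e : (n : ℝ) = q.1 + q.2 := by exact_mod_cast hq.symm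
    have a1 : (q.1 : ℝ) * t ≤ (q.1 : ℝ) * t1 := by gcongr
    have a2 : (q.2 : ℝ) * t ≤ (q.2 : ℝ) * t2 := by gcongr
    simp only [hσ]; rw [e]; linarith
  -- recursion
  have hrec : ∀ n : ℕ, ∀ q ∈ Finset.HasAntidiagonal.antidiagonal (n + 1),
      c q = PsiAux.g1 (fun q => h1 q * c q) q + PsiAux.g2 (fun q => h2 q * c q) q := by
    rintro n ⟨i, j⟩ hq
    rw [Finset.HasAntidiagonal.mem_antidiagonal] at hq
    simp only at hq
    have := hCrec i j (by positivity) (by positivity) (by omega) s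
    simp only [hc, PsiAux.g1, PsiAux.g2]
    rw [this]
    congr 1
    · rcases i with _ | i
      · rw [hCneg _ _ _ (Or.inl (by simp))]; simp
      · simp [hh1, hσ]
    · rcases j with _ | j
      · rw [hCneg _ _ _ (Or.inr (by simp))]; simp
      · simp [hh2, hσ]
  -- norm bounds
  set K : ℝ := k * (k * l1) + k * (k * l2) with hK
  have hK0 : 0 ≤ K := by positivity
  set N : ℕ → ℝ := fun n => ∑ q ∈ Finset.HasAntidiagonal.antidiagonal n, PsiAux.nm (c q) with hN
  have hN0 : ∀ n, 0 ≤ N n := fun n => Finset.sum_nonneg fun _ _ => PsiAux.nm_nonneg _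
  have hh : ∀ q, PsiAux.nm (h1 q * c q) + PsiAux.nm (h2 q * c q)
      ≤ K / σ q * PsiAux.nm (c q) := by
    intro q
    have b1 : PsiAux.nm (h1 q) ≤ (σ q)⁻¹ * (k * (k * l1)) := by
      simp only [hh1, H1mat]
      rw [PsiAux.nm_smul, abs_of_pos (inv_pos.2 (hσ0 q))]
      exact mul_le_mul_of_nonneg_left (PsiAux.nm_A1 k l1 m1 m2 _ hl1 hm1 hm2 (hσ0 q))
        (inv_pos.2 (hσ0 q)).le
    have b2 : PsiAux.nm (h2 q) ≤ (σ q)⁻¹ * (k * (k * l2)) := by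
      simp only [hh2, H2mat]
      rw [PsiAux.nm_smul, abs_of_pos (inv_pos.2 (hσ0 q))]
      exact mul_le_mul_of_nonneg_left (PsiAux.nm_A2 k l2 m1 m2 _ hl2 hm1 hm2 (hσ0 q))
        (inv_pos.2 (hσ0 q)).le
    have d1 := (PsiAux.nm_mul (h1 q) (c q)).trans
      (mul_le_mul_of_nonneg_right b1 (PsiAux.nm_nonneg _))
    have d2 := (PsiAux.nm_mul (h2 q) (c q)).trans
      (mul_le_mul_of_nonneg_right b2 (PsiAux.nm_nonneg _))
    refine (add_le_add d1 d2).trans (le_of_eq ?_)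
    rw [hK]; ring
  have hNrec : ∀ n : ℕ, N (n + 1) ≤ K / (s + n * t) * N n := by
    intro n
    calc N (n + 1) ≤ ∑ q ∈ Finset.HasAntidiagonal.antidiagonal (n + 1),
          (PsiAux.g1 (fun q => PsiAux.nm (h1 q * c q)) q
            + PsiAux.g2 (fun q => PsiAux.nm (h2 q * c q)) q) := by
          refine Finset.sum_le_sum fun q hq => ?_
          rw [hrec n q hq]
          refine (PsiAux.nm_add _ _).trans (add_le_add (le_of_eq ?_) (le_of_eq ?_))
          · simp only [PsiAux.g1]; split_ifs <;> simp [PsiAux.nm_zero]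
          · simp only [PsiAux.g2]; split_ifs <;> simp [PsiAux.nm_zero]
      _ = ∑ q ∈ Finset.HasAntidiagonal.antidiagonal n,
          (PsiAux.nm (h1 q * c q) + PsiAux.nm (h2 q * c q)) := PsiAux.sum_shift _ _ n
      _ ≤ ∑ q ∈ Finset.HasAntidiagonal.antidiagonal n, K / (s + n * t) * PsiAux.nm (c q) := by
          refine Finset.sum_le_sum fun q hq => (hh q).trans ?_
          refine mul_le_mul_of_nonneg_right ?_ (PsiAux.nm_nonneg _)
          have := hσn n q hq
          have : 0 < s + n * t := by positivity
          gcongr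
      _ = _ := by rw [hN, Finset.mul_sum]
  have hNsum : Summable N := by
    refine summable_of_ratio_norm_eventually_le (r := 1 / 2) (by norm_num) ?_
    have hev : ∀ᶠ n : ℕ in Filter.atTop, 2 * K / t ≤ (n : ℝ) :=
      tendsto_natCast_atTop_atTop.eventually_ge_atTop _
    filter_upwards [hev] with n hn
    rw [Real.norm_of_nonneg (hN0 _), Real.norm_of_nonneg (hN0 _)]
    refine (hNrec n).trans (mul_le_mul_of_nonneg_right ?_ (hN0 n))
    rw [div_le_iff₀ ht] at hn
    have : 0 < s + n * t := by positivity
    rw [div_le_iff₀ this]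
    linarith
  have hcsum : Summable fun q => PsiAux.nm (c q) :=
    PsiAux.summable_layers _ (fun _ => PsiAux.nm_nonneg _) hNsum
  set L : ℝ := PsiAux.nm (1 : Matrix (Fin k) (Fin k) ℝ) + s⁻¹ * PsiAux.nm B with hL
  have hD : ∀ q, PsiAux.nm (Dmat k B (σ q)) ≤ L := by
    intro q
    refine (PsiAux.nm_add _ _).trans ?_
    rw [PsiAux.nm_smul, abs_of_pos (inv_pos.2 (hσ0 q))]
    have := PsiAux.nm_nonneg B
    have := hσs q
    rw [hL]
    gcongr
  have habs : ∀ a b : Fin k, Summable fun q => |(Dmat k B (σ q) * c q) a b| := by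
    intro a b
    refine Summable.of_nonneg_of_le (fun _ => abs_nonneg _) (fun q => ?_) (hcsum.mul_left L)
    exact (PsiAux.entry_le _ a b).trans ((PsiAux.nm_mul _ _).trans
      (mul_le_mul_of_nonneg_right (hD q) (PsiAux.nm_nonneg _)))
  refine ⟨habs, ?_⟩
  have hsm : Summable fun q => Dmat k B (σ q) * c q :=
    Pi.summable.2 fun a => Pi.summable.2 fun b => (habs a b).of_abs
  have hmap : HasSum (fun q => p ᵥ* (Dmat k B (σ q) * c q))
      (p ᵥ* ∑' q, Dmat k B (σ q) * c q) :=
    hsm.hasSum.map (AddMonoidHom.mk' (fun M : Matrix (Fin k) (Fin k) ℝ => p ᵥ* M)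
      (fun A B => Matrix.vecMul_add A B p))
      (Continuous.matrix_vecMul continuous_const continuous_id)
  have hlim := (PsiAux.hasSum_layers _ _ hmap).tendsto_sum_nat
  -- the finite identity
  have hfin : ∀ n : ℕ, ψ s = ∑ m ∈ Finset.range n, ∑ q ∈ Finset.HasAntidiagonal.antidiagonal m,
      p ᵥ* (Dmat k B (σ q) * c q) + ∑ q ∈ Finset.HasAntidiagonal.antidiagonal n, ψ (σ q) ᵥ* c q := by
    intro n
    induction n with
    | zero => simp [hσ, hc, hC00]
    | succ n ih =>
      rw [ih, Finset.sum_range_succ, add_assoc]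
      congr 1
      have e1 : ∑ q ∈ Finset.HasAntidiagonal.antidiagonal (n + 1), ψ (σ q) ᵥ* c q
          = ∑ q ∈ Finset.HasAntidiagonal.antidiagonal (n + 1),
          (PsiAux.g1 (fun q => ψ (σ q + t1) ᵥ* (h1 q * c q)) q
            + PsiAux.g2 (fun q => ψ (σ q + t2) ᵥ* (h2 q * c q)) q) := by
        refine Finset.sum_congr rfl fun q hq => ?_
        rw [hrec n q hq, Matrix.vecMul_add]
        obtain ⟨i, j⟩ := q
        congr 1
        · rcases i with _ | i
          · simp [PsiAux.g1]
          · have : σ (i + 1, j) = σ (i, j) + t1 := by simp only [hσ]; push_cast; ring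
            simp [PsiAux.g1, this]
        · rcases j with _ | j
          · simp [PsiAux.g2]
          · have : σ (i, j + 1) = σ (i, j) + t2 := by simp only [hσ]; push_cast; ring
            simp [PsiAux.g2, this]
      rw [e1, PsiAux.sum_shift, ← Finset.sum_add_distrib]
      refine Finset.sum_congr rfl fun q _ => ?_
      conv_lhs => rw [heq (σ q) (hσ0 q)]
      simp only [Matrix.add_vecMul, Matrix.vecMul_vecMul, add_assoc, hh1, hh2]
  have hrem : Filter.Tendsto (fun n => ∑ q ∈ Finset.HasAntidiagonal.antidiagonal n, ψ (σ q) ᵥ* c q)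
      Filter.atTop (nhds 0) := by
    rw [tendsto_pi_nhds]
    intro b
    have hz : Filter.Tendsto (fun n => (k : ℝ) * N n) Filter.atTop (nhds 0) := by
      simpa using hNsum.tendsto_atTop_zero.const_mul (k : ℝ)
    refine squeeze_zero_norm (fun n => ?_) hz
    rw [Finset.sum_apply, Real.norm_eq_abs, hN, Finset.mul_sum]
    refine (Finset.abs_sum_le_sum_abs _ _).trans (Finset.sum_le_sum fun q _ => ?_)
    simp only [Matrix.vecMul, dotProduct]
    refine (Finset.abs_sum_le_sum_abs _ _).trans ?_
    calc ∑ a, |ψ (σ q) a * c q a b| ≤ ∑ _a : Fin k, PsiAux.nm (c q) := by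
          refine Finset.sum_le_sum fun a _ => ?_
          rw [abs_mul]
          calc _ ≤ 1 * |c q a b| :=
                mul_le_mul_of_nonneg_right (hbd _ (hσ0 q) a) (abs_nonneg _)
            _ ≤ _ := by rw [one_mul]; exact PsiAux.entry_le _ a b
      _ = _ := by simp
  have hfinal := hlim.add hrem
  rw [add_zero] at hfinal
  refine tendsto_nhds_unique ?_ hfinal
  exact tendsto_const_nhds.congr hfin
end

section
/- For each δ > 0, the double series Σ_{i≥0} Σ_{j≥0} C_{i,j}(s) is absolutely and uniformly convergent for all s > δ; precisely, Σ_{i≥0} Σ_{j≥0} sup_{s>δ} max_{a,b} |C_{i,j}(s)[a,b]| < ∞. -/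
open scoped ENNReal

lemma A1_bound (k : ℕ) (l1 m1 m2 s : ℝ) (hl1 : 0 < l1) (hm1 : 0 < m1) (hm2 : 0 < m2)
    (hs : 0 < s) (a b : Fin k) : |A1 k l1 m1 m2 s a b| ≤ l1 := by
  have ha : ((a : ℕ) : ℝ) + 1 ≤ k := by exact_mod_cast a.2
  have hb : ((b : ℕ) : ℝ) + 1 ≤ k := by exact_mod_cast b.2
  have ha0 : (0 : ℝ) ≤ ((a : ℕ) : ℝ) := by positivity
  have hb0 : (0 : ℝ) ≤ ((b : ℕ) : ℝ) := by positivity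
  have h1 : 0 ≤ ((k : ℝ) - 1 - (a : ℕ)) * m2 := mul_nonneg (by linarith) hm2.le
  have h2 : 0 ≤ ((k : ℝ) - (b : ℕ)) * m2 := mul_nonneg (by linarith) hm2.le
  have h3 : 0 ≤ (((a : ℕ) : ℝ) + 1) * m1 := by positivity
  have h4 : 0 ≤ ((b : ℕ) : ℝ) * m1 := by positivity
  simp only [A1, Matrix.of_apply]
  split_ifs
  · rw [abs_of_nonneg (by positivity), div_le_iff₀ (by positivity)]
    exact mul_le_mul_of_nonneg_left (by linarith) hl1.le
  · rw [abs_neg, abs_of_nonneg (by positivity), div_le_iff₀ (by positivity)]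
    exact mul_le_mul_of_nonneg_left (by linarith) hl1.le
  · simpa using hl1.le

lemma A2_bound (k : ℕ) (l2 m1 m2 s : ℝ) (hl2 : 0 < l2) (hm1 : 0 < m1) (hm2 : 0 < m2)
    (hs : 0 < s) (a b : Fin k) : |A2 k l2 m1 m2 s a b| ≤ l2 := by
  have ha : ((a : ℕ) : ℝ) + 1 ≤ k := by exact_mod_cast a.2
  have ha0 : (0 : ℝ) ≤ ((a : ℕ) : ℝ) := by positivity
  have h1 : 0 ≤ ((k : ℝ) - (a : ℕ)) * m2 := mul_nonneg (by linarith) hm2.le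
  have h3 : 0 ≤ ((a : ℕ) : ℝ) * m1 := by positivity
  simp only [A2, Matrix.of_apply]
  split_ifs
  · rw [abs_of_nonneg (by positivity), div_le_iff₀ (by positivity)]
    exact mul_le_mul_of_nonneg_left (by linarith) hl2.le
  · rw [abs_neg, abs_of_nonneg (by positivity), div_le_iff₀ (by positivity), mul_assoc]
    exact mul_le_mul_of_nonneg_left (by linarith) hl2.le
  · simpa using hl2.le

lemma smul_mul_bound (k : ℕ) (A C : Matrix (Fin k) (Fin k) ℝ) (l M s e : ℝ)
    (he : 0 < e) (hes : e ≤ s) (hM : 0 ≤ M)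
    (hA : ∀ a b, |A a b| ≤ l) (hC : ∀ a b, |C a b| ≤ M) (a b : Fin k) :
    |((s⁻¹ • A) * C) a b| ≤ k * l / e * M := by
  have hl : 0 ≤ l := (abs_nonneg _).trans (hA a a)
  rw [Matrix.mul_apply]
  refine (Finset.abs_sum_le_sum_abs _ _).trans ?_
  have : ∀ c ∈ (Finset.univ : Finset (Fin k)),
      |(s⁻¹ • A) a c * C c b| ≤ e⁻¹ * l * M := by
    intro c _
    rw [Matrix.smul_apply, smul_eq_mul, abs_mul, abs_mul,
      abs_of_pos (inv_pos.mpr (he.trans_le hes))]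
    gcongr
    · exact hA a c
    · exact hC c b
  refine (Finset.sum_le_card_nsmul _ _ _ this).trans (le_of_eq ?_)
  simp only [Finset.card_univ, Fintype.card_fin, nsmul_eq_mul]
  field_simp

/-- For each `δ > 0`, the double series `Σ_{i,j≥0} C_{i,j}(s)` is absolutely and uniformly
convergent for `s > δ`: the sum over `i,j` of `sup_{s>δ} max_{a,b} |C_{i,j}(s)[a,b]|`
is finite. -/
theorem Cij_abs_unif_convergent
    (k : ℕ) (hk : 1 ≤ k) (l1 l2 m1 m2 t1 t2 : ℝ)
    (hl1 : 0 < l1) (hl2 : 0 < l2) (hm1 : 0 < m1) (hm2 : 0 < m2)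
    (ht1 : 0 < t1) (ht2 : 0 < t2)
    (C : ℤ → ℤ → ℝ → Matrix (Fin k) (Fin k) ℝ)
    (hC00 : ∀ s : ℝ, C 0 0 s = 1)
    (hCneg : ∀ (i j : ℤ) (s : ℝ), i < 0 ∨ j < 0 → C i j s = 0)
    (hCrec : ∀ (i j : ℤ), 0 ≤ i → 0 ≤ j → 0 < i + j → ∀ s : ℝ,
      C i j s =
        H1mat k l1 m1 m2 (s + ((i : ℝ) - 1) * t1 + (j : ℝ) * t2) * C (i - 1) j s
          + H2mat k l2 m1 m2 (s + (i : ℝ) * t1 + ((j : ℝ) - 1) * t2) * C i (j - 1) s)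
    (δ : ℝ) (hδ : 0 < δ) :
    (∑' p : ℕ × ℕ, ⨆ (s : ℝ) (_ : δ < s), ⨆ (a : Fin k), ⨆ (b : Fin k),
      ENNReal.ofReal |C (p.1 : ℤ) (p.2 : ℤ) s a b|) < ⊤ := by
  set η : ℝ := min δ (min t1 t2) with hη
  have hη0 : 0 < η := by positivity
  have hηδ : η ≤ δ := min_le_left _ _
  have hη1 : η ≤ t1 := (min_le_right _ _).trans (min_le_left _ _)
  have hη2 : η ≤ t2 := (min_le_right _ _).trans (min_le_right _ _)
  set R : ℝ := k * (l1 + l2) / η with hR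
  have hR0 : 0 ≤ R := by positivity
  have key : ∀ n : ℕ, ∀ i j : ℤ, i + j = n → ∀ s : ℝ, δ < s → ∀ a b : Fin k,
      |C i j s a b| ≤ R ^ n / n.factorial := by
    intro n
    induction n with
    | zero =>
      intro i j hij s hs a b
      by_cases h : i < 0 ∨ j < 0
      · simp [hCneg i j s h]
      · push Not at h
        have hi : i = 0 := by push_cast at hij; omega
        have hj : j = 0 := by push_cast at hij; omega
        subst hi hj
        rw [hC00, Matrix.one_apply]
        split_ifs <;> simp
    | succ n ih =>
      intro i j hij s hs a b
      by_cases h : i < 0 ∨ j < 0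
      · rw [hCneg i j s h]
        simp only [Matrix.zero_apply, abs_zero]
        positivity
      push Not at h
      obtain ⟨hi, hj⟩ := h
      push_cast at hij
      have hijR : (i : ℝ) + j = n + 1 := by exact_mod_cast hij
      have hiR : (0 : ℝ) ≤ i := by exact_mod_cast hi
      have hjR : (0 : ℝ) ≤ j := by exact_mod_cast hj
      set M : ℝ := R ^ n / n.factorial with hMd
      have hM : 0 ≤ M := by positivity
      have he : 0 < η * (n + 1) := by positivity
      rw [hCrec i j hi hj (by omega) s, Matrix.add_apply]
      have b1 : |(H1mat k l1 m1 m2 (s + ((i : ℝ) - 1) * t1 + (j : ℝ) * t2) * C (i - 1) j s) a b|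
          ≤ k * l1 / (η * (n + 1)) * M := by
        by_cases hi0 : i = 0
        · rw [hCneg (i - 1) j s (Or.inl (by omega))]
          simp only [Matrix.mul_zero, Matrix.zero_apply, abs_zero]
          positivity
        have hi1 : (1 : ℝ) ≤ i := by exact_mod_cast (by omega : (1 : ℤ) ≤ i)
        have hes : η * (n + 1) ≤ s + ((i : ℝ) - 1) * t1 + (j : ℝ) * t2 := by
          rw [← hijR]
          have e1 := mul_le_mul_of_nonneg_left hη1 (by linarith : (0 : ℝ) ≤ (i : ℝ) - 1)
          have e2 := mul_le_mul_of_nonneg_left hη2 hjR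
          linarith
        exact smul_mul_bound k _ _ l1 M _ _ he hes hM
          (A1_bound k l1 m1 m2 _ hl1 hm1 hm2 (he.trans_le hes))
          (ih (i - 1) j (by omega) s hs) a b
      have b2 : |(H2mat k l2 m1 m2 (s + (i : ℝ) * t1 + ((j : ℝ) - 1) * t2) * C i (j - 1) s) a b|
          ≤ k * l2 / (η * (n + 1)) * M := by
        by_cases hj0 : j = 0
        · rw [hCneg i (j - 1) s (Or.inr (by omega))]
          simp only [Matrix.mul_zero, Matrix.zero_apply, abs_zero]
          positivity
        have hj1 : (1 : ℝ) ≤ j := by exact_mod_cast (by omega : (1 : ℤ) ≤ j)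
        have hes : η * (n + 1) ≤ s + (i : ℝ) * t1 + ((j : ℝ) - 1) * t2 := by
          rw [← hijR]
          have e1 := mul_le_mul_of_nonneg_left hη2 (by linarith : (0 : ℝ) ≤ (j : ℝ) - 1)
          have e2 := mul_le_mul_of_nonneg_left hη1 hiR
          linarith
        exact smul_mul_bound k _ _ l2 M _ _ he hes hM
          (A2_bound k l2 m1 m2 _ hl2 hm1 hm2 (he.trans_le hes))
          (ih i (j - 1) (by omega) s hs) a b
      refine (abs_add_le _ _).trans ((add_le_add b1 b2).trans (le_of_eq ?_))
      rw [hMd, pow_succ, Nat.factorial_succ]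
      push_cast
      have hf : (n.factorial : ℝ) ≠ 0 := by positivity
      have : (n : ℝ) + 1 ≠ 0 := by positivity
      rw [show R ^ n * R = R ^ n * (k * (l1 + l2) / η) by rw [← hR]]
      field_simp
  have hsum : Summable fun p : ℕ × ℕ =>
      (R ^ p.1 / p.1.factorial) * (R ^ p.2 / p.2.factorial) :=
    (Real.summable_pow_div_factorial R).mul_of_nonneg (Real.summable_pow_div_factorial R)
      (fun n => by positivity) (fun n => by positivity)
  have hnn : ∀ p : ℕ × ℕ, 0 ≤ (R ^ p.1 / p.1.factorial) * (R ^ p.2 / p.2.factorial) :=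
    fun p => by positivity
  refine lt_of_le_of_lt (ENNReal.tsum_le_tsum (g := fun p : ℕ × ℕ => ENNReal.ofReal
    ((R ^ p.1 / p.1.factorial) * (R ^ p.2 / p.2.factorial))) ?_) ?_
  · intro p
    refine iSup₂_le fun s hs => iSup_le fun a => iSup_le fun b => ENNReal.ofReal_le_ofReal ?_
    refine (key (p.1 + p.2) p.1 p.2 (by push_cast; rfl) s hs a b).trans ?_
    rw [div_mul_div_comm, ← pow_add]
    gcongr
    exact_mod_cast Nat.le_of_dvd (Nat.factorial_pos _)
      (Nat.factorial_mul_factorial_dvd_factorial_add p.1 p.2)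
  · rw [← ENNReal.ofReal_tsum_of_nonneg hnn hsum]
    exact ENNReal.ofReal_lt_top
end

section
/- For each δ > 0 there exist a constant M ≥ 0 and a real number r with 0 < r < 1 such that for all s > δ, all integers i, j ≥ 0, and all matrix indices a, b, one has |C_{i,j}(s)[a,b]| ≤ M·r^{i+j}. -/
open scoped ENNReal

theorem gb_frac (l x y : ℝ) (hl : 0 < l) (hx : 0 ≤ x) (hxy : x ≤ y) (hy : 0 < y) :
    |l * x / y| ≤ l := by
  rw [abs_of_nonneg (by positivity), div_le_iff₀ hy]
  exact mul_le_mul_of_nonneg_left hxy hl.le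

theorem gb_A1 (k : ℕ) (l m1 m2 s : ℝ) (hl : 0 < l) (hm1 : 0 < m1) (hm2 : 0 < m2) (hs : 0 < s)
    (a b : Fin k) : |A1 k l m1 m2 s a b| ≤ l := by
  have ha : ((a : ℕ) : ℝ) + 1 ≤ k := by exact_mod_cast a.2
  have hb : ((b : ℕ) : ℝ) + 1 ≤ k := by exact_mod_cast b.2
  have h0 : 0 ≤ ((a : ℕ) : ℝ) := Nat.cast_nonneg _
  have h1 : 0 ≤ ((b : ℕ) : ℝ) := Nat.cast_nonneg _
  simp only [A1, Matrix.of_apply]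
  split_ifs
  · have e1 : 0 ≤ ((k : ℝ) - 1 - (a : ℕ)) * m2 := mul_nonneg (by linarith) hm2.le
    have e2 : 0 ≤ (((a : ℕ) : ℝ) + 1) * m1 := by positivity
    apply gb_frac _ _ _ hl <;> linarith
  · rw [abs_neg]
    have e1 : 0 ≤ ((k : ℝ) - (b : ℕ)) * m2 := mul_nonneg (by linarith) hm2.le
    have e2 : 0 ≤ ((b : ℕ) : ℝ) * m1 := by positivity
    apply gb_frac _ _ _ hl <;> linarith
  · simpa using hl.le

theorem gb_A2 (k : ℕ) (l m1 m2 s : ℝ) (hl : 0 < l) (hm1 : 0 < m1) (hm2 : 0 < m2) (hs : 0 < s)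
    (a b : Fin k) : |A2 k l m1 m2 s a b| ≤ l := by
  have ha : ((a : ℕ) : ℝ) + 1 ≤ k := by exact_mod_cast a.2
  have h0 : 0 ≤ ((a : ℕ) : ℝ) := Nat.cast_nonneg _
  have e1 : 0 ≤ ((k : ℝ) - (a : ℕ)) * m2 := mul_nonneg (by linarith) hm2.le
  have e2 : 0 ≤ ((a : ℕ) : ℝ) * m1 := by positivity
  simp only [A2, Matrix.of_apply]
  split_ifs
  · apply gb_frac _ _ _ hl <;> linarith
  · rw [abs_neg, mul_assoc]
    apply gb_frac _ _ _ hl <;> linarith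
  · simpa using hl.le

theorem gb_mul (k : ℕ) (A D : Matrix (Fin k) (Fin k) ℝ) (l s v P : ℝ) (hl : 0 < l)
    (hv : 0 < v) (hvs : v ≤ s) (hA : ∀ a b, |A a b| ≤ l) (hD : ∀ a b, |D a b| ≤ P)
    (a b : Fin k) : |((s⁻¹ • A) * D) a b| ≤ k * l / v * P := by
  rw [Matrix.mul_apply]
  refine (Finset.abs_sum_le_sum_abs _ _).trans ?_
  have : ∀ c ∈ Finset.univ, |(s⁻¹ • A) a c * D c b| ≤ l / v * P := by
    intro c _
    have hs : 0 < s := hv.trans_le hvs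
    rw [abs_mul, Matrix.smul_apply, smul_eq_mul, abs_mul, abs_of_pos (inv_pos.2 hs)]
    refine mul_le_mul ?_ (hD c b) (abs_nonneg _) (by positivity)
    rw [inv_mul_eq_div]
    exact div_le_div₀ hl.le (hA a c) hv hvs
  refine (Finset.sum_le_card_nsmul _ _ _ this).trans (le_of_eq ?_)
  simp only [Finset.card_univ, Fintype.card_fin, nsmul_eq_mul]
  ring

/-- For each `δ > 0` there are constants `M ≥ 0` and `0 < r < 1` such that for all `s > δ`,
all `i, j ≥ 0` and all matrix indices `a, b`, `|C_{i,j}(s)[a,b]| ≤ M·r^(i+j)`. -/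
theorem geometric_bound_Cij
    (k : ℕ) (hk : 1 ≤ k) (l1 l2 m1 m2 t1 t2 : ℝ)
    (hl1 : 0 < l1) (hl2 : 0 < l2) (hm1 : 0 < m1) (hm2 : 0 < m2)
    (ht1 : 0 < t1) (ht2 : 0 < t2)
    (C : ℤ → ℤ → ℝ → Matrix (Fin k) (Fin k) ℝ)
    (hC00 : ∀ s : ℝ, C 0 0 s = 1)
    (hCneg : ∀ (i j : ℤ) (s : ℝ), i < 0 ∨ j < 0 → C i j s = 0)
    (hCrec : ∀ (i j : ℤ), 0 ≤ i → 0 ≤ j → 0 < i + j → ∀ s : ℝ,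
      C i j s =
        H1mat k l1 m1 m2 (s + ((i : ℝ) - 1) * t1 + (j : ℝ) * t2) * C (i - 1) j s
          + H2mat k l2 m1 m2 (s + (i : ℝ) * t1 + ((j : ℝ) - 1) * t2) * C i (j - 1) s)
    (δ : ℝ) (hδ : 0 < δ) :
    ∃ M : ℝ, 0 ≤ M ∧ ∃ r : ℝ, 0 < r ∧ r < 1 ∧
      ∀ s : ℝ, δ < s → ∀ (i j : ℕ) (a b : Fin k),
        |C (i : ℤ) (j : ℤ) s a b| ≤ M * r ^ (i + j) := by
  obtain ⟨u, hu, huδ, hu1, hu2⟩ : ∃ u : ℝ, 0 < u ∧ u ≤ δ ∧ u ≤ t1 ∧ u ≤ t2 :=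
    ⟨min δ (min t1 t2), by positivity, min_le_left _ _, (min_le_right _ _).trans (min_le_left _ _),
      (min_le_right _ _).trans (min_le_right _ _)⟩
  set L : ℝ := k * (l1 + l2) with hL
  have hL0 : 0 ≤ L := by positivity
  have key : ∀ s : ℝ, δ < s → ∀ (n i j : ℕ), i + j = n → ∀ a b : Fin k,
      |C (i : ℤ) (j : ℤ) s a b| ≤ (L / u) ^ n / (n.factorial : ℝ) := by
    intro s hs n
    induction n with
    | zero =>
      intro i j hij a b
      obtain ⟨rfl, rfl⟩ : i = 0 ∧ j = 0 := by omega
      simp only [Nat.cast_zero, hC00, Matrix.one_apply]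
      split_ifs <;> simp
    | succ n ih =>
      intro i j hij a b
      set P : ℝ := (L / u) ^ n / (n.factorial : ℝ) with hP
      have hP0 : 0 ≤ P := by positivity
      have hv : 0 < u * ((n : ℝ) + 1) := by positivity
      have hijR : (i : ℝ) + j = n + 1 := by exact_mod_cast hij
      have hj0 : (0 : ℝ) ≤ j := Nat.cast_nonneg _
      have hi0 : (0 : ℝ) ≤ i := Nat.cast_nonneg _
      rw [hCrec i j (by omega) (by omega) (by omega) s, Matrix.add_apply]
      have b1 : |(H1mat k l1 m1 m2 (s + (((i : ℤ) : ℝ) - 1) * t1 + ((j : ℤ) : ℝ) * t2)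
          * C ((i : ℤ) - 1) j s) a b| ≤ k * l1 / (u * ((n : ℝ) + 1)) * P := by
        rcases Nat.eq_zero_or_pos i with h | h
        · rw [hCneg ((i : ℤ) - 1) j s (by omega)]
          simp only [Matrix.mul_zero, Matrix.zero_apply, abs_zero]
          positivity
        · have h1 : (1 : ℝ) ≤ i := by exact_mod_cast h
          have hvs : u * ((n : ℝ) + 1) ≤
              s + (((i : ℤ) : ℝ) - 1) * t1 + ((j : ℤ) : ℝ) * t2 := by
            push_cast
            have e1 := mul_le_mul_of_nonneg_left hu1 (sub_nonneg.2 h1)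
            have e2 := mul_le_mul_of_nonneg_left hu2 hj0
            rw [← hijR]
            linarith
          refine gb_mul k _ _ l1 _ _ P hl1 hv hvs
            (gb_A1 k l1 m1 m2 _ hl1 hm1 hm2 (hv.trans_le hvs)) ?_ a b
          have := ih (i - 1) j (by omega)
          rwa [Nat.cast_sub h, Nat.cast_one] at this
      have b2 : |(H2mat k l2 m1 m2 (s + ((i : ℤ) : ℝ) * t1 + (((j : ℤ) : ℝ) - 1) * t2)
          * C (i : ℤ) ((j : ℤ) - 1) s) a b| ≤ k * l2 / (u * ((n : ℝ) + 1)) * P := by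
        rcases Nat.eq_zero_or_pos j with h | h
        · rw [hCneg i ((j : ℤ) - 1) s (by omega)]
          simp only [Matrix.mul_zero, Matrix.zero_apply, abs_zero]
          positivity
        · have h1 : (1 : ℝ) ≤ j := by exact_mod_cast h
          have hvs : u * ((n : ℝ) + 1) ≤
              s + ((i : ℤ) : ℝ) * t1 + (((j : ℤ) : ℝ) - 1) * t2 := by
            push_cast
            have e1 := mul_le_mul_of_nonneg_left hu2 (sub_nonneg.2 h1)
            have e2 := mul_le_mul_of_nonneg_left hu1 hi0
            rw [← hijR]
            linarith
          refine gb_mul k _ _ l2 _ _ P hl2 hv hvs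
            (gb_A2 k l2 m1 m2 _ hl2 hm1 hm2 (hv.trans_le hvs)) ?_ a b
          have := ih i (j - 1) (by omega)
          rwa [Nat.cast_sub h, Nat.cast_one] at this
      refine (abs_add_le _ _).trans ((add_le_add b1 b2).trans (le_of_eq ?_))
      have hf : (n.factorial : ℝ) ≠ 0 := by positivity
      rw [hP, hL, Nat.factorial_succ, pow_succ]
      generalize ((k : ℝ) * (l1 + l2) / u) ^ n = X
      push_cast
      field_simp
  refine ⟨Real.exp (2 * (L / u)), (Real.exp_pos _).le, 1 / 2, by norm_num, by norm_num, ?_⟩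
  intro s hs i j a b
  refine (key s hs (i + j) i j rfl a b).trans ?_
  have h := Real.pow_div_factorial_le_exp (2 * (L / u)) (by positivity) (i + j)
  have h2 := mul_le_mul_of_nonneg_right h (by positivity : (0 : ℝ) ≤ (1 / 2) ^ (i + j))
  refine le_trans (le_of_eq ?_) h2
  rw [div_mul_eq_mul_div, ← mul_pow]
  congr 2
  ring
end

section
/- For each δ > 0, the double series Σ_{i≥0} Σ_{j≥0} D_{i,j}(s)·C_{i,j}(s) is absolutely and uniformly convergent for all s > δ; precisely, Σ_{i≥0} Σ_{j≥0} sup_{s>δ} max_{a,b} |(D_{i,j}(s)·C_{i,j}(s))[a,b]| < ∞. -/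
open scoped ENNReal

open scoped Matrix.Norms.Operator in
theorem aux_entry_le (k : ℕ) (A : Matrix (Fin k) (Fin k) ℝ) (a b : Fin k) : |A a b| ≤ ‖A‖ := by
  have h1 : ‖A a b‖₊ ≤ ∑ j, ‖A a j‖₊ :=
    Finset.single_le_sum (f := fun j => ‖A a j‖₊) (fun _ _ => zero_le) (Finset.mem_univ b)
  have h2 : ∑ j, ‖A a j‖₊ ≤ ‖A‖₊ := by
    rw [Matrix.linfty_opNNNorm_def]
    exact Finset.le_sup (f := fun i => ∑ j, ‖A i j‖₊) (Finset.mem_univ a)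
  have h3 : ‖A a b‖ ≤ ‖A‖ := by exact_mod_cast h1.trans h2
  simpa using h3

open scoped Matrix.Norms.Operator in
theorem aux_norm_le (k : ℕ) (A : Matrix (Fin k) (Fin k) ℝ) (l : ℝ) (hl : 0 ≤ l)
    (h : ∀ a b, |A a b| ≤ l) : ‖A‖ ≤ k * l := by
  lift l to NNReal using hl
  have : ‖A‖₊ ≤ k * l := by
    rw [Matrix.linfty_opNNNorm_def]
    refine Finset.sup_le fun i _ => ?_
    have : ∑ j, ‖A i j‖₊ ≤ ∑ _j : Fin k, l := by
      refine Finset.sum_le_sum fun j _ => ?_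
      have := h i j
      rw [← Real.norm_eq_abs] at this
      exact_mod_cast this
    simpa using this
  exact_mod_cast this

theorem aux_frac (l p q : ℝ) (hl : 0 ≤ l) (hp : 0 ≤ p) (hpq : p ≤ q) : |l * p / q| ≤ l := by
  rw [abs_of_nonneg (by have := hp.trans hpq; positivity), mul_div_assoc]
  exact mul_le_of_le_one_right hl (div_le_one_of_le₀ hpq (hp.trans hpq))

open scoped Matrix.Norms.Operator in
theorem aux_A1 (k : ℕ) (l m1 m2 s : ℝ) (hl : 0 < l) (h1 : 0 < m1) (h2 : 0 < m2) (hs : 0 < s) :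
    ‖A1 k l m1 m2 s‖ ≤ k * l := by
  refine aux_norm_le k _ l hl.le fun a b => ?_
  have ha : (0 : ℝ) ≤ (k : ℝ) - 1 - (a : ℕ) := by
    have : (((a : ℕ) + 1 : ℕ) : ℝ) ≤ k := by exact_mod_cast a.2
    push_cast at this; linarith
  have hb : (0 : ℝ) ≤ (k : ℝ) - (b : ℕ) := by
    have : ((b : ℕ) : ℝ) ≤ k := by exact_mod_cast b.2.le
    linarith
  have e1 := mul_nonneg ha h2.le
  have e2 := mul_nonneg hb h2.le
  have e3 : 0 ≤ (((a : ℕ) : ℝ) + 1) * m1 := by positivity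
  have e4 : 0 ≤ ((b : ℕ) : ℝ) * m1 := by positivity
  simp only [A1, Matrix.of_apply]
  split_ifs
  · exact aux_frac _ _ _ hl.le (by linarith) (by linarith)
  · rw [abs_neg]
    exact aux_frac _ _ _ hl.le (by linarith) (by linarith)
  · simpa using hl.le

open scoped Matrix.Norms.Operator in
theorem aux_A2 (k : ℕ) (l m1 m2 s : ℝ) (hl : 0 < l) (h1 : 0 < m1) (h2 : 0 < m2) (hs : 0 < s) :
    ‖A2 k l m1 m2 s‖ ≤ k * l := by
  refine aux_norm_le k _ l hl.le fun a b => ?_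
  have ha : (0 : ℝ) ≤ (k : ℝ) - (a : ℕ) := by
    have : ((a : ℕ) : ℝ) ≤ k := by exact_mod_cast a.2.le
    linarith
  have e1 := mul_nonneg ha h2.le
  have e3 : 0 ≤ ((a : ℕ) : ℝ) * m1 := by positivity
  simp only [A2, Matrix.of_apply]
  split_ifs
  · exact aux_frac _ _ _ hl.le (by linarith) (by linarith)
  · rw [abs_neg, mul_assoc]
    exact aux_frac _ _ _ hl.le (by linarith) (by linarith)
  · simpa using hl.le

/-- The scalar majorant `K^i / i!`. -/
noncomputable def auxd (K : ℝ) (i : ℕ) : ℝ := K ^ i / (i.factorial : ℝ)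

theorem auxd_nonneg (K : ℝ) (hK : 0 ≤ K) (i : ℕ) : 0 ≤ auxd K i := by
  unfold auxd; positivity

theorem auxd_succ (K : ℝ) (i : ℕ) : K * auxd K i = (i + 1) * auxd K (i + 1) := by
  unfold auxd
  rw [Nat.factorial_succ]
  push_cast
  field_simp
  ring

open scoped Matrix.Norms.Operator in
theorem aux_smul (k : ℕ) (A : Matrix (Fin k) (Fin k) ℝ) (x t L n : ℝ) (hA : ‖A‖ ≤ L)
    (ht : 0 < t) (hn : 0 < n) (hx : n * t ≤ x) : ‖x⁻¹ • A‖ ≤ L / t / n := by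
  have h0 : 0 < n * t := by positivity
  have hL : 0 ≤ L := (norm_nonneg _).trans hA
  rw [norm_smul, Real.norm_of_nonneg (inv_nonneg.2 (h0.le.trans hx))]
  calc x⁻¹ * ‖A‖ ≤ (n * t)⁻¹ * L := by gcongr
    _ = L / t / n := by field_simp

open scoped Matrix.Norms.Operator in
theorem aux_C
    (k : ℕ) (l1 l2 m1 m2 t1 t2 : ℝ)
    (hl1 : 0 < l1) (hl2 : 0 < l2) (hm1 : 0 < m1) (hm2 : 0 < m2)
    (C : ℤ → ℤ → ℝ → Matrix (Fin k) (Fin k) ℝ)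
    (hC00 : ∀ s : ℝ, C 0 0 s = 1)
    (hCneg : ∀ (i j : ℤ) (s : ℝ), i < 0 ∨ j < 0 → C i j s = 0)
    (hCrec : ∀ (i j : ℤ), 0 ≤ i → 0 ≤ j → 0 < i + j → ∀ s : ℝ,
      C i j s =
        H1mat k l1 m1 m2 (s + ((i : ℝ) - 1) * t1 + (j : ℝ) * t2) * C (i - 1) j s
          + H2mat k l2 m1 m2 (s + (i : ℝ) * t1 + ((j : ℝ) - 1) * t2) * C i (j - 1) s)
    (t : ℝ) (ht : 0 < t) (htt1 : t ≤ t1) (htt2 : t ≤ t2)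
    (s : ℝ) (hs : t ≤ s) (n : ℕ) : ∀ i j : ℕ, i + j = n →
    ‖C i j s‖ ≤ ‖(1 : Matrix (Fin k) (Fin k) ℝ)‖ *
      (auxd (k * (l1 + l2) / t) i * auxd (k * (l1 + l2) / t) j) := by
  set K : ℝ := k * (l1 + l2) / t with hKdef
  set M := ‖(1 : Matrix (Fin k) (Fin k) ℝ)‖ with hM
  have hM0 : 0 ≤ M := norm_nonneg _
  have hK : 0 ≤ K := by positivity
  have H1b : ∀ i j : ℕ, ‖H1mat k l1 m1 m2 (s + (i : ℝ) * t1 + (j : ℝ) * t2)‖ ≤ K / (i + j + 1) := by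
    intro i j
    have hx : ((i : ℝ) + j + 1) * t ≤ s + (i : ℝ) * t1 + (j : ℝ) * t2 := by
      have h1 : (i : ℝ) * t ≤ i * t1 := by gcongr
      have h2 : (j : ℝ) * t ≤ j * t2 := by gcongr
      linarith
    have hn : (0 : ℝ) < (i : ℝ) + j + 1 := by positivity
    have hx0 := (mul_pos hn ht).trans_le hx
    refine aux_smul k _ _ t _ _ ((aux_A1 k l1 m1 m2 _ hl1 hm1 hm2 hx0).trans ?_) ht hn hx
    gcongr; linarith
  have H2b : ∀ i j : ℕ, ‖H2mat k l2 m1 m2 (s + (i : ℝ) * t1 + (j : ℝ) * t2)‖ ≤ K / (i + j + 1) := by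
    intro i j
    have hx : ((i : ℝ) + j + 1) * t ≤ s + (i : ℝ) * t1 + (j : ℝ) * t2 := by
      have h1 : (i : ℝ) * t ≤ i * t1 := by gcongr
      have h2 : (j : ℝ) * t ≤ j * t2 := by gcongr
      linarith
    have hn : (0 : ℝ) < (i : ℝ) + j + 1 := by positivity
    have hx0 := (mul_pos hn ht).trans_le hx
    refine aux_smul k _ _ t _ _ ((aux_A2 k l2 m1 m2 _ hl2 hm1 hm2 hx0).trans ?_) ht hn hx
    gcongr; linarith
  induction n with
  | zero =>
    intro i j hij
    obtain ⟨rfl, rfl⟩ : i = 0 ∧ j = 0 := by omega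
    simp [hC00, auxd, hM]
  | succ n ih =>
    intro i j hij
    have hn : (0 : ℝ) < (n : ℝ) + 1 := by positivity
    -- contribution of the first term
    have T1 : ‖H1mat k l1 m1 m2 (s + (((i : ℤ) : ℝ) - 1) * t1 + ((j : ℤ) : ℝ) * t2)
        * C ((i : ℤ) - 1) j s‖ ≤ i / (n + 1) * (M * (auxd K i * auxd K j)) := by
      rcases i with _ | i
      · rw [hCneg _ _ _ (Or.inl (by simp))]; simp
      · have e : (((i + 1 : ℕ) : ℤ) - 1) = (i : ℤ) := by push_cast; ring
        have e' : ((((i + 1 : ℕ) : ℤ) : ℝ) - 1) = (i : ℝ) := by push_cast; ring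
        rw [e, e']
        have hnn : (i : ℝ) + j = n := by exact_mod_cast (by omega : i + j = n)
        have h := H1b i j
        rw [hnn] at h
        refine (norm_mul_le _ _).trans ?_
        refine (mul_le_mul h (ih i j (by omega)) (norm_nonneg _) (by positivity)).trans (le_of_eq ?_)
        have := auxd_succ K i
        push_cast
        calc K / (n + 1) * (M * (auxd K i * auxd K j))
            = (K * auxd K i) * (M * auxd K j) / (n + 1) := by ring
          _ = _ := by rw [this]; ring
    have T2 : ‖H2mat k l2 m1 m2 (s + ((i : ℤ) : ℝ) * t1 + (((j : ℤ) : ℝ) - 1) * t2)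
        * C i ((j : ℤ) - 1) s‖ ≤ j / (n + 1) * (M * (auxd K i * auxd K j)) := by
      rcases j with _ | j
      · rw [hCneg _ _ _ (Or.inr (by simp))]; simp
      · have e : (((j + 1 : ℕ) : ℤ) - 1) = (j : ℤ) := by push_cast; ring
        have e' : ((((j + 1 : ℕ) : ℤ) : ℝ) - 1) = (j : ℝ) := by push_cast; ring
        rw [e, e']
        have hnn : (i : ℝ) + j = n := by exact_mod_cast (by omega : i + j = n)
        have h := H2b i j
        rw [hnn] at h
        refine (norm_mul_le _ _).trans ?_
        refine (mul_le_mul h (ih i j (by omega)) (norm_nonneg _) (by positivity)).trans (le_of_eq ?_)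
        have := auxd_succ K j
        push_cast
        calc K / (n + 1) * (M * (auxd K i * auxd K j))
            = (K * auxd K j) * (M * auxd K i) / (n + 1) := by ring
          _ = _ := by rw [this]; ring
    rw [hCrec i j (by positivity) (by positivity) (by omega) s]
    refine (norm_add_le _ _).trans ((add_le_add T1 T2).trans (le_of_eq ?_))
    have hnn : (i : ℝ) + j = n + 1 := by exact_mod_cast hij
    rw [← add_mul, ← add_div, hnn, div_self hn.ne', one_mul]

open scoped Matrix.Norms.Operator in
theorem aux_DC
    (k : ℕ) (l1 l2 m1 m2 t1 t2 : ℝ)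
    (hl1 : 0 < l1) (hl2 : 0 < l2) (hm1 : 0 < m1) (hm2 : 0 < m2)
    (ht1 : 0 < t1) (ht2 : 0 < t2)
    (B : Matrix (Fin k) (Fin k) ℝ)
    (C : ℤ → ℤ → ℝ → Matrix (Fin k) (Fin k) ℝ)
    (hC00 : ∀ s : ℝ, C 0 0 s = 1)
    (hCneg : ∀ (i j : ℤ) (s : ℝ), i < 0 ∨ j < 0 → C i j s = 0)
    (hCrec : ∀ (i j : ℤ), 0 ≤ i → 0 ≤ j → 0 < i + j → ∀ s : ℝ,
      C i j s =
        H1mat k l1 m1 m2 (s + ((i : ℝ) - 1) * t1 + (j : ℝ) * t2) * C (i - 1) j s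
          + H2mat k l2 m1 m2 (s + (i : ℝ) * t1 + ((j : ℝ) - 1) * t2) * C i (j - 1) s)
    (δ : ℝ) (hδ : 0 < δ)
    (t : ℝ) (ht : 0 < t) (htd : t ≤ δ) (htt1 : t ≤ t1) (htt2 : t ≤ t2) :
    ∃ K Q : ℝ, 0 ≤ K ∧ 0 ≤ Q ∧ ∀ (i j : ℕ) (s : ℝ), δ < s → ∀ a b : Fin k,
      |(Dmat k B (s + (i : ℝ) * t1 + (j : ℝ) * t2) * C (i : ℤ) (j : ℤ) s) a b|
        ≤ Q * (auxd K i * auxd K j) := by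
  refine ⟨k * (l1 + l2) / t, (‖(1 : Matrix (Fin k) (Fin k) ℝ)‖ + δ⁻¹ * ‖B‖) *
    ‖(1 : Matrix (Fin k) (Fin k) ℝ)‖, by positivity, by positivity, ?_⟩
  intro i j s hs a b
  refine (aux_entry_le k _ a b).trans ((norm_mul_le _ _).trans ?_)
  rw [mul_assoc]
  refine mul_le_mul ?_ (aux_C k l1 l2 m1 m2 t1 t2 hl1 hl2 hm1 hm2 C hC00 hCneg hCrec t ht htt1 htt2
    s (htd.trans hs.le) (i + j) i j rfl) (norm_nonneg _) (by positivity)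
  have hx : δ ≤ s + (i : ℝ) * t1 + (j : ℝ) * t2 := by
    have h1 : 0 ≤ (i : ℝ) * t1 := by positivity
    have h2 : 0 ≤ (j : ℝ) * t2 := by positivity
    linarith
  unfold Dmat
  refine (norm_add_le _ _).trans ?_
  rw [norm_smul, Real.norm_of_nonneg (inv_nonneg.2 (hδ.le.trans hx))]
  gcongr

/-- For each `δ > 0`, the double series `Σ_{i,j≥0} D_{i,j}(s)·C_{i,j}(s)` is absolutely and
uniformly convergent for `s > δ`: the sum over `i,j` of
`sup_{s>δ} max_{a,b} |(D_{i,j}(s)C_{i,j}(s))[a,b]|` is finite. -/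
theorem DijCij_abs_unif_convergent
    (k : ℕ) (hk : 1 ≤ k) (l1 l2 m1 m2 t1 t2 : ℝ)
    (hl1 : 0 < l1) (hl2 : 0 < l2) (hm1 : 0 < m1) (hm2 : 0 < m2)
    (ht1 : 0 < t1) (ht2 : 0 < t2)
    (B : Matrix (Fin k) (Fin k) ℝ)
    (C : ℤ → ℤ → ℝ → Matrix (Fin k) (Fin k) ℝ)
    (hC00 : ∀ s : ℝ, C 0 0 s = 1)
    (hCneg : ∀ (i j : ℤ) (s : ℝ), i < 0 ∨ j < 0 → C i j s = 0)
    (hCrec : ∀ (i j : ℤ), 0 ≤ i → 0 ≤ j → 0 < i + j → ∀ s : ℝ,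
      C i j s =
        H1mat k l1 m1 m2 (s + ((i : ℝ) - 1) * t1 + (j : ℝ) * t2) * C (i - 1) j s
          + H2mat k l2 m1 m2 (s + (i : ℝ) * t1 + ((j : ℝ) - 1) * t2) * C i (j - 1) s)
    (δ : ℝ) (hδ : 0 < δ) :
    (∑' p : ℕ × ℕ, ⨆ (s : ℝ) (_ : δ < s), ⨆ (a : Fin k), ⨆ (b : Fin k),
      ENNReal.ofReal
        |(Dmat k B (s + (p.1 : ℝ) * t1 + (p.2 : ℝ) * t2) * C (p.1 : ℤ) (p.2 : ℤ) s) a b|)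
      < ⊤ := by
  obtain ⟨t, ht, htd, htt1, htt2⟩ : ∃ t : ℝ, 0 < t ∧ t ≤ δ ∧ t ≤ t1 ∧ t ≤ t2 :=
    ⟨min δ (min t1 t2), by positivity, min_le_left _ _,
      (min_le_right _ _).trans (min_le_left _ _), (min_le_right _ _).trans (min_le_right _ _)⟩
  obtain ⟨K, Q, hK, hQ, hb⟩ := aux_DC k l1 l2 m1 m2 t1 t2 hl1 hl2 hm1 hm2 ht1 ht2 B C hC00 hCneg
    hCrec δ hδ t ht htd htt1 htt2
  have hsum : Summable (fun p : ℕ × ℕ => Q * (auxd K p.1 * auxd K p.2)) :=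
    ((Real.summable_pow_div_factorial K).mul_of_nonneg (Real.summable_pow_div_factorial K)
      (auxd_nonneg K hK) (auxd_nonneg K hK)).mul_left Q
  refine lt_of_le_of_lt (ENNReal.tsum_le_tsum (g := fun p : ℕ × ℕ =>
    ENNReal.ofReal (Q * (auxd K p.1 * auxd K p.2))) fun p => ?_) hsum.tsum_ofReal_lt_top
  refine iSup₂_le fun s hs => iSup_le fun a => iSup_le fun b => ?_
  exact ENNReal.ofReal_le_ofReal (hb p.1 p.2 s hs a b)
end

section
/- For each δ > 0, the double series Σ_{i≥0} Σ_{j≥0} C′_{i,j}(s) is absolutely and uniformly convergent for all s > δ; precisely, Σ_{i≥0} Σ_{j≥0} sup_{s>δ} max_{a,b} |C′_{i,j}(s)[a,b]| < ∞. -/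
open scoped ENNReal

/-- The entrywise derivative of `H_1`. -/
noncomputable def H1d (k : ℕ) (l1 m1 m2 : ℝ) (s : ℝ) : Matrix (Fin k) (Fin k) ℝ :=
  Matrix.of fun a b => deriv (fun t => H1mat k l1 m1 m2 t a b) s

/-- The entrywise derivative of `H_2`. -/
noncomputable def H2d (k : ℕ) (l2 m1 m2 : ℝ) (s : ℝ) : Matrix (Fin k) (Fin k) ℝ :=
  Matrix.of fun a b => deriv (fun t => H2mat k l2 m1 m2 t a b) s

lemma aux_entry (L l e p w x : ℝ) (hL : |L| ≤ l) (he0 : 0 ≤ e) (he1 : e ≤ 1) (hp : 0 ≤ p)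
    (hpw : p ≤ w) (hx : 0 < x) :
    |x⁻¹ * (L * (e * x + p) / (x + w))| ≤ l / x ∧
    |deriv (fun t : ℝ => t⁻¹ * (L * (e * t + p) / (t + w))) x| ≤ 2 * l / x ^ 2 := by
  have hxw : 0 < x + w := by linarith
  have hg0 : 0 ≤ (e * x + p) / (x + w) := by positivity
  have hg1 : (e * x + p) / (x + w) ≤ 1 := by
    rw [div_le_one hxw]; nlinarith
  have hl : 0 ≤ l := (abs_nonneg L).trans hL
  have hx1 : 0 ≤ x⁻¹ := by positivity
  have hLg : |L * ((e * x + p) / (x + w))| ≤ l := by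
    rw [abs_mul, abs_of_nonneg hg0]
    calc _ ≤ l * 1 := mul_le_mul hL hg1 hg0 hl
      _ = l := mul_one l
  constructor
  · rw [abs_mul, abs_of_nonneg hx1, mul_div_assoc, div_eq_inv_mul l x]
    exact mul_le_mul_of_nonneg_left hLg hx1
  · have h1 : HasDerivAt (fun t : ℝ => L * (e * t + p)) (L * (e * 1)) x :=
      (((hasDerivAt_id x).const_mul e).add_const p).const_mul L
    have h2 : HasDerivAt (fun t : ℝ => t + w) 1 x := (hasDerivAt_id x).add_const w
    have h3 := (hasDerivAt_inv hx.ne').mul (h1.div h2 hxw.ne')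
    have h4 : deriv (fun t : ℝ => t⁻¹ * (L * (e * t + p) / (t + w))) x = _ := h3.deriv
    rw [h4]
    have e1 : (-(x ^ 2)⁻¹ * (L * (e * x + p) / (x + w)) +
        x⁻¹ * ((L * (e * 1) * (x + w) - L * (e * x + p) * 1) / (x + w) ^ 2)) =
        -((x ^ 2)⁻¹ * (L * ((e * x + p) / (x + w)))) +
         (x⁻¹ * (L * ((e * w - p) / (x + w) ^ 2))) := by
      field_simp
      ring
    have hew : |e * w - p| ≤ x + w := by
      rw [abs_le]; constructor <;> nlinarith
    have hq : |(e * w - p) / (x + w) ^ 2| ≤ x⁻¹ := by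
      rw [abs_div, abs_of_pos (by positivity : (0:ℝ) < (x + w) ^ 2), div_le_iff₀ (by positivity),
        inv_mul_eq_div, le_div_iff₀ hx]
      have : x ≤ x + w := by linarith
      nlinarith [abs_nonneg (e * w - p)]
    have b1 : |(x ^ 2)⁻¹ * (L * ((e * x + p) / (x + w)))| ≤ (x ^ 2)⁻¹ * l := by
      rw [abs_mul, abs_of_nonneg (by positivity : 0 ≤ (x ^ 2)⁻¹)]
      exact mul_le_mul_of_nonneg_left hLg (by positivity)
    have b2 : |x⁻¹ * (L * ((e * w - p) / (x + w) ^ 2))| ≤ x⁻¹ * (l * x⁻¹) := by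
      rw [abs_mul, abs_of_nonneg hx1, abs_mul]
      exact mul_le_mul_of_nonneg_left (mul_le_mul hL hq (abs_nonneg _) hl) hx1
    have e2 : 2 * l / x ^ 2 = (x ^ 2)⁻¹ * l + x⁻¹ * (l * x⁻¹) := by
      field_simp; ring
    rw [e2]
    refine (le_of_eq (congrArg abs e1)).trans ((abs_add_le _ _).trans ?_)
    rw [abs_neg]
    exact add_le_add b1 b2

lemma aux_H1 (k : ℕ) (l1 m1 m2 : ℝ) (hl1 : 0 < l1) (hm1 : 0 < m1) (hm2 : 0 < m2)
    (x : ℝ) (hx : 0 < x) (a b : Fin k) :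
    |H1mat k l1 m1 m2 x a b| ≤ l1 / x ∧ |H1d k l1 m1 m2 x a b| ≤ 2 * l1 / x ^ 2 := by
  have key : ∃ L e p w : ℝ, |L| ≤ l1 ∧ 0 ≤ e ∧ e ≤ 1 ∧ 0 ≤ p ∧ p ≤ w ∧
      ∀ t, H1mat k l1 m1 m2 t a b = t⁻¹ * (L * (e * t + p) / (t + w)) := by
    have ha : ((a : ℕ) : ℝ) + 1 ≤ k := by exact_mod_cast a.2
    have hb : ((b : ℕ) : ℝ) + 1 ≤ k := by exact_mod_cast b.2
    have ha0 : (0 : ℝ) ≤ ((a : ℕ) : ℝ) := Nat.cast_nonneg _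
    have hb0 : (0 : ℝ) ≤ ((b : ℕ) : ℝ) := Nat.cast_nonneg _
    by_cases h : (a : ℕ) = (b : ℕ)
    · refine ⟨l1, 1, ((k : ℝ) - 1 - (a : ℕ)) * m2,
        (((a : ℕ) : ℝ) + 1) * m1 + ((k : ℝ) - 1 - (a : ℕ)) * m2, (abs_of_pos hl1).le,
        zero_le_one, le_rfl, mul_nonneg (by linarith) hm2.le,
        le_add_of_nonneg_left (by positivity), fun t => ?_⟩
      simp only [H1mat, A1, Matrix.smul_apply, Matrix.of_apply, if_pos h, smul_eq_mul, one_mul,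
        add_assoc]
    · by_cases h' : (a : ℕ) + 1 = (b : ℕ)
      · refine ⟨-l1, 0, ((k : ℝ) - (b : ℕ)) * m2,
          ((b : ℕ) : ℝ) * m1 + ((k : ℝ) - (b : ℕ)) * m2, by rw [abs_neg, abs_of_pos hl1],
          le_rfl, zero_le_one, mul_nonneg (by linarith) hm2.le,
          le_add_of_nonneg_left (by positivity), fun t => ?_⟩
        simp only [H1mat, A1, Matrix.smul_apply, Matrix.of_apply, if_neg h, if_pos h',
          smul_eq_mul, zero_mul, zero_add, add_assoc, neg_mul, neg_div]
      · refine ⟨0, 0, 0, 0, by simpa using hl1.le, le_rfl, zero_le_one, le_rfl, le_rfl,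
          fun t => ?_⟩
        simp [H1mat, A1, if_neg h, if_neg h']
  obtain ⟨L, e, p, w, hL, he0, he1, hp, hpw, hH⟩ := key
  have := aux_entry L l1 e p w x hL he0 he1 hp hpw hx
  simpa only [H1d, Matrix.of_apply, hH] using this

lemma aux_H2 (k : ℕ) (l2 m1 m2 : ℝ) (hl2 : 0 < l2) (hm1 : 0 < m1) (hm2 : 0 < m2)
    (x : ℝ) (hx : 0 < x) (a b : Fin k) :
    |H2mat k l2 m1 m2 x a b| ≤ l2 / x ∧ |H2d k l2 m1 m2 x a b| ≤ 2 * l2 / x ^ 2 := by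
  have key : ∃ L e p w : ℝ, |L| ≤ l2 ∧ 0 ≤ e ∧ e ≤ 1 ∧ 0 ≤ p ∧ p ≤ w ∧
      ∀ t, H2mat k l2 m1 m2 t a b = t⁻¹ * (L * (e * t + p) / (t + w)) := by
    have ha : ((a : ℕ) : ℝ) + 1 ≤ k := by exact_mod_cast a.2
    have ha0 : (0 : ℝ) ≤ ((a : ℕ) : ℝ) := Nat.cast_nonneg _
    have hka : 0 ≤ ((k : ℝ) - (a : ℕ)) * m2 := mul_nonneg (by linarith) hm2.le
    by_cases h : (a : ℕ) = (b : ℕ)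
    · refine ⟨l2, 1, ((a : ℕ) : ℝ) * m1,
        ((a : ℕ) : ℝ) * m1 + ((k : ℝ) - (a : ℕ)) * m2, (abs_of_pos hl2).le,
        zero_le_one, le_rfl, by positivity, le_add_of_nonneg_right hka, fun t => ?_⟩
      simp only [H2mat, A2, Matrix.smul_apply, Matrix.of_apply, if_pos h, smul_eq_mul, one_mul,
        add_assoc]
    · by_cases h' : (a : ℕ) = (b : ℕ) + 1
      · refine ⟨-l2, 0, ((a : ℕ) : ℝ) * m1,
          ((a : ℕ) : ℝ) * m1 + ((k : ℝ) - (a : ℕ)) * m2, by rw [abs_neg, abs_of_pos hl2],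
          le_rfl, zero_le_one, by positivity, le_add_of_nonneg_right hka, fun t => ?_⟩
        simp only [H2mat, A2, Matrix.smul_apply, Matrix.of_apply, if_neg h, if_pos h',
          smul_eq_mul, zero_mul, zero_add, add_assoc, neg_mul, neg_div, mul_assoc]
      · refine ⟨0, 0, 0, 0, by simpa using hl2.le, le_rfl, zero_le_one, le_rfl, le_rfl,
          fun t => ?_⟩
        simp [H2mat, A2, if_neg h, if_neg h']
  obtain ⟨L, e, p, w, hL, he0, he1, hp, hpw, hH⟩ := key
  have := aux_entry L l2 e p w x hL he0 he1 hp hpw hx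
  simpa only [H2d, Matrix.of_apply, hH] using this

lemma aux_mul {k : ℕ} (X Y : Matrix (Fin k) (Fin k) ℝ) (u v : ℝ) (hu : 0 ≤ u)
    (hX : ∀ a b, |X a b| ≤ u) (hY : ∀ a b, |Y a b| ≤ v) (a b : Fin k) :
    |(X * Y) a b| ≤ k * (u * v) := by
  rw [Matrix.mul_apply]
  refine (Finset.abs_sum_le_sum_abs _ _).trans ?_
  refine (Finset.sum_le_card_nsmul _ _ (u * v) fun c _ => ?_).trans (by simp)
  rw [abs_mul]
  exact mul_le_mul (hX a c) (hY c b) (abs_nonneg _) hu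

/-- The majorant `R^(i+j) / (i! j!)`. -/
noncomputable def auxB (R : ℝ) (i j : ℕ) : ℝ := R ^ i / (i.factorial : ℝ) * (R ^ j / (j.factorial : ℝ))

lemma auxB_pos (R : ℝ) (hR : 0 < R) (i j : ℕ) : 0 < auxB R i j := by
  unfold auxB; positivity

lemma aux_pred (R : ℝ) (hR : 0 < R) (i : ℕ) :
    R ^ i / (i.factorial : ℝ) = ((i + 1 : ℕ) : ℝ) / R * (R ^ (i + 1) / ((i + 1).factorial : ℝ)) := by
  rw [Nat.factorial_succ]
  push_cast
  field_simp
  ring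

/-- One term of the recursion. -/
lemma aux_term {k : ℕ} (hk : 1 ≤ k) (M c n x R B i : ℝ) (hM : 0 < M) (hc : 0 < c) (hn : 0 < n)
    (hx : c * n ≤ x) (hR : R = 2 * k * M / c) (hB : 0 ≤ B) (hi : 0 ≤ i)
    (X Y : Matrix (Fin k) (Fin k) ℝ)
    (hX : ∀ a b, |X a b| ≤ M / x) (hY : ∀ a b, |Y a b| ≤ i / R * B) (a b : Fin k) :
    |(X * Y) a b| ≤ i / (2 * n) * B := by
  have hk' : (0 : ℝ) < k := by exact_mod_cast hk
  have hRp : 0 < R := by rw [hR]; positivity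
  have hcn : 0 < c * n := by positivity
  have hX' : ∀ a b, |X a b| ≤ M / (c * n) := fun a b =>
    (hX a b).trans (div_le_div_of_nonneg_left hM.le hcn hx)
  refine (aux_mul X Y _ _ (by positivity) hX' hY a b).trans (le_of_eq ?_)
  rw [hR]
  field_simp

/-- For each `δ > 0`, the double series `Σ_{i,j≥0} C'_{i,j}(s)` is absolutely and uniformly
convergent for `s > δ`: the sum over `i,j` of `sup_{s>δ} max_{a,b} |C'_{i,j}(s)[a,b]|`
is finite. -/
theorem C'ij_abs_unif_convergent
    (k : ℕ) (hk : 1 ≤ k) (l1 l2 m1 m2 t1 t2 : ℝ)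
    (hl1 : 0 < l1) (hl2 : 0 < l2) (hm1 : 0 < m1) (hm2 : 0 < m2)
    (ht1 : 0 < t1) (ht2 : 0 < t2)
    (C C' : ℤ → ℤ → ℝ → Matrix (Fin k) (Fin k) ℝ)
    (hC00 : ∀ s : ℝ, C 0 0 s = 1)
    (hCneg : ∀ (i j : ℤ) (s : ℝ), i < 0 ∨ j < 0 → C i j s = 0)
    (hCrec : ∀ (i j : ℤ), 0 ≤ i → 0 ≤ j → 0 < i + j → ∀ s : ℝ,
      C i j s =
        H1mat k l1 m1 m2 (s + ((i : ℝ) - 1) * t1 + (j : ℝ) * t2) * C (i - 1) j s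
          + H2mat k l2 m1 m2 (s + (i : ℝ) * t1 + ((j : ℝ) - 1) * t2) * C i (j - 1) s)
    (hC'00 : ∀ s : ℝ, C' 0 0 s = 0)
    (hC'neg : ∀ (i j : ℤ) (s : ℝ), i < 0 ∨ j < 0 → C' i j s = 0)
    (hC'rec : ∀ (i j : ℤ), 0 ≤ i → 0 ≤ j → 0 < i + j → ∀ s : ℝ,
      C' i j s =
        H1mat k l1 m1 m2 (s + ((i : ℝ) - 1) * t1 + (j : ℝ) * t2) * C' (i - 1) j s
          + H2mat k l2 m1 m2 (s + (i : ℝ) * t1 + ((j : ℝ) - 1) * t2) * C' i (j - 1) s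
          + H1d k l1 m1 m2 (s + ((i : ℝ) - 1) * t1 + (j : ℝ) * t2) * C (i - 1) j s
          + H2d k l2 m1 m2 (s + (i : ℝ) * t1 + ((j : ℝ) - 1) * t2) * C i (j - 1) s)
    (δ : ℝ) (hδ : 0 < δ) :
    (∑' p : ℕ × ℕ, ⨆ (s : ℝ) (_ : δ < s), ⨆ (a : Fin k), ⨆ (b : Fin k),
      ENNReal.ofReal |C' (p.1 : ℤ) (p.2 : ℤ) s a b|) < ⊤ := by
  obtain ⟨c, hc, hcδ, hct1, hct2⟩ : ∃ c : ℝ, 0 < c ∧ c ≤ δ ∧ c ≤ t1 ∧ c ≤ t2 :=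
    ⟨min δ (min t1 t2), lt_min hδ (lt_min ht1 ht2), min_le_left _ _,
      (min_le_right _ _).trans (min_le_left _ _), (min_le_right _ _).trans (min_le_right _ _)⟩
  have hk' : (0 : ℝ) < k := by exact_mod_cast hk
  obtain ⟨M, hM, hM1, hM2, hM3, hM4⟩ : ∃ M : ℝ, 0 < M ∧ l1 ≤ M ∧ l2 ≤ M ∧
      2 * l1 / c ≤ M ∧ 2 * l2 / c ≤ M := by
    have h1 : 0 < 2 * l1 / c := by positivity
    have h2 : 0 < 2 * l2 / c := by positivity
    exact ⟨l1 + l2 + 2 * l1 / c + 2 * l2 / c, by positivity, by linarith, by linarith,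
      by linarith, by linarith⟩
  obtain ⟨R, hR⟩ : ∃ R : ℝ, R = 2 * k * M / c := ⟨_, rfl⟩
  have hRp : 0 < R := by rw [hR]; positivity
  have dd : ∀ l x : ℝ, 0 < l → 2 * l / c ≤ M → c ≤ x → 2 * l / x ^ 2 ≤ M / x := by
    intro l x hl hlM hx
    have hx0 : 0 < x := hc.trans_le hx
    rw [div_le_div_iff₀ (by positivity) hx0]
    have : 2 * l ≤ M * x := by
      rw [div_le_iff₀ hc] at hlM
      nlinarith
    nlinarith
  have hH1 : ∀ x, c ≤ x → ∀ a b, |H1mat k l1 m1 m2 x a b| ≤ M / x := fun x hx a b =>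
    (aux_H1 k l1 m1 m2 hl1 hm1 hm2 x (hc.trans_le hx) a b).1.trans
      (div_le_div_of_nonneg_right hM1 (hc.trans_le hx).le)
  have hH2 : ∀ x, c ≤ x → ∀ a b, |H2mat k l2 m1 m2 x a b| ≤ M / x := fun x hx a b =>
    (aux_H2 k l2 m1 m2 hl2 hm1 hm2 x (hc.trans_le hx) a b).1.trans
      (div_le_div_of_nonneg_right hM2 (hc.trans_le hx).le)
  have hD1 : ∀ x, c ≤ x → ∀ a b, |H1d k l1 m1 m2 x a b| ≤ M / x := fun x hx a b =>
    (aux_H1 k l1 m1 m2 hl1 hm1 hm2 x (hc.trans_le hx) a b).2.trans (dd l1 x hl1 hM3 hx)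
  have hD2 : ∀ x, c ≤ x → ∀ a b, |H2d k l2 m1 m2 x a b| ≤ M / x := fun x hx a b =>
    (aux_H2 k l2 m1 m2 hl2 hm1 hm2 x (hc.trans_le hx) a b).2.trans (dd l2 x hl2 hM4 hx)
  have main : ∀ n : ℕ, ∀ i j : ℕ, i + j = n → ∀ s : ℝ, δ < s → ∀ a b : Fin k,
      |C (i : ℤ) (j : ℤ) s a b| ≤ auxB R i j ∧ |C' (i : ℤ) (j : ℤ) s a b| ≤ auxB R i j := by
    intro n
    induction n with
    | zero =>
      intro i j hij s hs a b
      obtain ⟨rfl, rfl⟩ : i = 0 ∧ j = 0 := by omega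
      simp only [Nat.cast_zero, hC00, hC'00, auxB, Matrix.one_apply, Matrix.zero_apply]
      constructor
      · split_ifs <;> simp
      · simp
    | succ n ih =>
      intro i j hij s hs
      have hB := (auxB_pos R hRp i j).le
      have hij' : (i : ℝ) + j = n + 1 := by exact_mod_cast hij
      have hn : (0 : ℝ) < n + 1 := by positivity
      have hi0 : (0 : ℝ) ≤ i := Nat.cast_nonneg _
      have hj0 : (0 : ℝ) ≤ j := Nat.cast_nonneg _
      -- terms coming from `(i - 1, j)`
      have T1 : ∀ (F : ℝ → Matrix (Fin k) (Fin k) ℝ) (_ : ∀ x, c ≤ x → ∀ a b, |F x a b| ≤ M / x)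
          (Y : Matrix (Fin k) (Fin k) ℝ) (_ : Y = C ((i : ℤ) - 1) j s ∨ Y = C' ((i : ℤ) - 1) j s)
          (a b : Fin k), |(F (s + (((i : ℤ) : ℝ) - 1) * t1 + ((j : ℤ) : ℝ) * t2) * Y) a b| ≤
            i / (2 * ((n : ℝ) + 1)) * auxB R i j := by
        intro F hF Y hY a b
        rcases Nat.eq_zero_or_pos i with h0 | hpos
        · have hneg : (i : ℤ) - 1 < 0 := by omega
          have : Y = 0 := by
            rcases hY with rfl | rfl
            · exact hCneg _ _ _ (Or.inl hneg)
            · exact hC'neg _ _ _ (Or.inl hneg)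
          rw [this]
          simp only [mul_zero, Matrix.zero_apply, abs_zero]
          positivity
        · obtain ⟨i', rfl⟩ : ∃ i', i = i' + 1 := ⟨i - 1, by omega⟩
          have hx : c * ((n : ℝ) + 1) ≤
              s + ((((i' + 1 : ℕ) : ℤ) : ℝ) - 1) * t1 + ((j : ℤ) : ℝ) * t2 := by
            rw [← hij']
            push_cast
            have := mul_le_mul_of_nonneg_left hct1 (Nat.cast_nonneg (α := ℝ) i')
            have := mul_le_mul_of_nonneg_left hct2 hj0
            nlinarith
          refine aux_term hk M c _ _ R _ _ hM hc hn hx hR hB hi0 _ _ (hF _ ?_) ?_ a b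
          · refine le_trans ?_ hx
            have : (0 : ℝ) ≤ n := Nat.cast_nonneg _
            nlinarith
          · intro a b
            have h1 := ih i' j (by omega) s hs a b
            have e1 : ((i' + 1 : ℕ) : ℤ) - 1 = (i' : ℤ) := by push_cast; ring
            have e2 : auxB R i' j = ((i' + 1 : ℕ) : ℝ) / R * auxB R (i' + 1) j := by
              unfold auxB; rw [aux_pred R hRp i']; ring
            rw [e1] at hY
            rw [← e2]
            rcases hY with rfl | rfl
            · exact h1.1
            · exact h1.2
      have T2 : ∀ (F : ℝ → Matrix (Fin k) (Fin k) ℝ) (_ : ∀ x, c ≤ x → ∀ a b, |F x a b| ≤ M / x)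
          (Y : Matrix (Fin k) (Fin k) ℝ) (_ : Y = C i ((j : ℤ) - 1) s ∨ Y = C' i ((j : ℤ) - 1) s)
          (a b : Fin k), |(F (s + ((i : ℤ) : ℝ) * t1 + (((j : ℤ) : ℝ) - 1) * t2) * Y) a b| ≤
            j / (2 * ((n : ℝ) + 1)) * auxB R i j := by
        intro F hF Y hY a b
        rcases Nat.eq_zero_or_pos j with h0 | hpos
        · have hneg : (j : ℤ) - 1 < 0 := by omega
          have : Y = 0 := by
            rcases hY with rfl | rfl
            · exact hCneg _ _ _ (Or.inr hneg)
            · exact hC'neg _ _ _ (Or.inr hneg)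
          rw [this]
          simp only [mul_zero, Matrix.zero_apply, abs_zero]
          positivity
        · obtain ⟨j', rfl⟩ : ∃ j', j = j' + 1 := ⟨j - 1, by omega⟩
          have hx : c * ((n : ℝ) + 1) ≤
              s + ((i : ℤ) : ℝ) * t1 + ((((j' + 1 : ℕ) : ℤ) : ℝ) - 1) * t2 := by
            rw [← hij']
            push_cast
            have := mul_le_mul_of_nonneg_left hct2 (Nat.cast_nonneg (α := ℝ) j')
            have := mul_le_mul_of_nonneg_left hct1 hi0
            nlinarith
          refine aux_term hk M c _ _ R _ _ hM hc hn hx hR hB hj0 _ _ (hF _ ?_) ?_ a b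
          · refine le_trans ?_ hx
            have : (0 : ℝ) ≤ n := Nat.cast_nonneg _
            nlinarith
          · intro a b
            have h1 := ih i j' (by omega) s hs a b
            have e1 : ((j' + 1 : ℕ) : ℤ) - 1 = (j' : ℤ) := by push_cast; ring
            have e2 : auxB R i j' = ((j' + 1 : ℕ) : ℝ) / R * auxB R i (j' + 1) := by
              unfold auxB; rw [aux_pred R hRp j']; ring
            rw [e1] at hY
            rw [← e2]
            rcases hY with rfl | rfl
            · exact h1.1
            · exact h1.2
      have tot : (i : ℝ) / (2 * ((n : ℝ) + 1)) * auxB R i j +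
          (j : ℝ) / (2 * ((n : ℝ) + 1)) * auxB R i j = auxB R i j / 2 := by
        rw [← add_mul, ← add_div, hij']
        field_simp
      intro a b
      have p1 := T1 _ hH1 _ (Or.inl rfl) a b
      have p2 := T2 _ hH2 _ (Or.inl rfl) a b
      have q1 := T1 _ hH1 _ (Or.inr rfl) a b
      have q2 := T2 _ hH2 _ (Or.inr rfl) a b
      have r1 := T1 _ hD1 _ (Or.inl rfl) a b
      have r2 := T2 _ hD2 _ (Or.inl rfl) a b
      constructor
      · rw [hCrec i j (by omega) (by omega) (by omega) s, Matrix.add_apply]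
        refine (abs_add_le _ _).trans ?_
        linarith
      · rw [hC'rec i j (by omega) (by omega) (by omega) s, Matrix.add_apply, Matrix.add_apply,
          Matrix.add_apply]
        refine (abs_add_le _ _).trans ?_
        refine (add_le_add_left ((abs_add_three _ _ _)) _).trans ?_
        linarith
  have hsum : Summable (fun p : ℕ × ℕ => auxB R p.1 p.2) := by
    have h := Real.summable_pow_div_factorial R
    exact h.mul_of_nonneg h (fun i => by positivity) (fun i => by positivity)
  have hle : (∑' p : ℕ × ℕ, ⨆ (s : ℝ) (_ : δ < s), ⨆ (a : Fin k), ⨆ (b : Fin k),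
      ENNReal.ofReal |C' (p.1 : ℤ) (p.2 : ℤ) s a b|) ≤
      ∑' p : ℕ × ℕ, ENNReal.ofReal (auxB R p.1 p.2) := by
    refine ENNReal.tsum_le_tsum fun p => ?_
    refine iSup₂_le fun s hs => iSup_le fun a => iSup_le fun b => ?_
    exact ENNReal.ofReal_le_ofReal (main _ p.1 p.2 rfl s hs a b).2
  refine hle.trans_lt ?_
  rw [← ENNReal.ofReal_tsum_of_nonneg (fun p => (auxB_pos R hRp _ _).le) hsum]
  exact ENNReal.ofReal_lt_top
end

section
/- For each s > 0, the matrix-valued function C(s) = Σ_{i≥0} Σ_{j≥0} D_{i,j}(s)·C_{i,j}(s) is differentiable at s (entrywise), and its derivative is C′(s) = Σ_{i≥0} Σ_{j≥0} ( D′_{i,j}(s)·C_{i,j}(s) + D_{i,j}(s)·C′_{i,j}(s) ), where D′_{i,j}(s) denotes the entrywise derivative of D_{i,j} at s; in particular this last series converges. -/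
open scoped ENNReal

/-- The entrywise derivative of `D`. -/
noncomputable def Dd (k : ℕ) (B : Matrix (Fin k) (Fin k) ℝ) (s : ℝ) :
    Matrix (Fin k) (Fin k) ℝ :=
  Matrix.of fun a b => deriv (fun t => Dmat k B t a b) s

/-- entrywise bound -/
def Bd {k : ℕ} (P : Matrix (Fin k) (Fin k) ℝ) (m : ℝ) : Prop := ∀ a b, |P a b| ≤ m

/-- entrywise derivative -/
def MD {k : ℕ} (P : ℝ → Matrix (Fin k) (Fin k) ℝ) (P' : Matrix (Fin k) (Fin k) ℝ) (t : ℝ) : Prop :=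
  ∀ a b, HasDerivAt (fun x => P x a b) (P' a b) t

lemma Bd.mul {k : ℕ} {P Q : Matrix (Fin k) (Fin k) ℝ} {m n : ℝ} (hm : 0 ≤ m)
    (hP : Bd P m) (hQ : Bd Q n) : Bd (P * Q) (k * m * n) := by
  intro a b
  rw [Matrix.mul_apply]
  refine (Finset.abs_sum_le_sum_abs _ _).trans ?_
  have : ∀ c ∈ (Finset.univ : Finset (Fin k)), |P a c * Q c b| ≤ m * n := by
    intro c _
    rw [abs_mul]
    exact mul_le_mul (hP a c) (hQ c b) (abs_nonneg _) hm
  refine (Finset.sum_le_sum this).trans ?_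
  simp [mul_assoc]

lemma Bd.add {k : ℕ} {P Q : Matrix (Fin k) (Fin k) ℝ} {m n : ℝ}
    (hP : Bd P m) (hQ : Bd Q n) : Bd (P + Q) (m + n) := by
  intro a b
  exact (abs_add_le _ _).trans (add_le_add (hP a b) (hQ a b))

lemma MD.mul {k : ℕ} {P Q : ℝ → Matrix (Fin k) (Fin k) ℝ} {P' Q' : Matrix (Fin k) (Fin k) ℝ} {t : ℝ}
    (hP : MD P P' t) (hQ : MD Q Q' t) : MD (fun x => P x * Q x) (P' * Q t + P t * Q') t := by
  intro a b
  simp only [Matrix.mul_apply, Matrix.add_apply, ← Finset.sum_add_distrib]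
  exact HasDerivAt.fun_sum fun c _ => (hP a c).mul (hQ c b)

lemma MD.add {k : ℕ} {P Q : ℝ → Matrix (Fin k) (Fin k) ℝ} {P' Q' : Matrix (Fin k) (Fin k) ℝ} {t : ℝ}
    (hP : MD P P' t) (hQ : MD Q Q' t) : MD (fun x => P x + Q x) (P' + Q') t := by
  intro a b
  exact (hP a b).add (hQ a b)

lemma MD.shift {k : ℕ} {P : ℝ → Matrix (Fin k) (Fin k) ℝ} {P' : Matrix (Fin k) (Fin k) ℝ} {t u v : ℝ}
    (hP : MD P P' (t + u + v)) : MD (fun x => P (x + u + v)) P' t := by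
  intro a b
  have h := hP a b
  rw [add_assoc] at h
  simpa only [add_assoc] using h.comp_add_const t (u + v)

lemma scalar_fact {l al be w : ℝ} (hw : 0 ≤ w) (hal : |al| ≤ l) (hbe : |be| ≤ l * w)
    {d s : ℝ} (hd : 0 < d) (hs : d ≤ s) :
    |s⁻¹ * ((al * s + be) / (s + w))| ≤ l * (1 + 3 / d) / s ∧
    ∃ y, HasDerivAt (fun s : ℝ => s⁻¹ * ((al * s + be) / (s + w))) y s ∧
      |y| ≤ l * (1 + 3 / d) / s := by
  have hs0 : 0 < s := hd.trans_le hs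
  have hsw : 0 < s + w := by linarith
  have hl : 0 ≤ l := (abs_nonneg _).trans hal
  have h1 : |(al * s + be) / (s + w)| ≤ l := by
    rw [abs_div, abs_of_pos hsw, div_le_iff₀ hsw]
    refine (abs_add_le _ _).trans ?_
    rw [abs_mul, abs_of_pos hs0]
    nlinarith
  have h2 : |(al * w - be) / (s + w) ^ 2| ≤ 2 * l / s := by
    rw [abs_div, abs_of_pos (pow_pos hsw 2), div_le_div_iff₀ (pow_pos hsw 2) hs0]
    have : |al * w - be| ≤ 2 * l * w := by
      refine (abs_sub _ _).trans ?_
      rw [abs_mul, abs_of_nonneg hw]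
      nlinarith
    have h3 : w * s ≤ (s + w) ^ 2 := by nlinarith
    calc |al * w - be| * s ≤ 2 * l * w * s := by gcongr
      _ = 2 * l * (w * s) := by ring
      _ ≤ _ := by gcongr
  have hsi : 1 / s ≤ 1 / d := one_div_le_one_div_of_le hd hs
  refine ⟨?_, ?_⟩
  · rw [abs_mul, abs_inv, abs_of_pos hs0, inv_mul_eq_div]
    gcongr
    refine h1.trans ?_
    have : 0 ≤ l * (3 / d) := by positivity
    linarith
  · refine ⟨-(s⁻¹ * s⁻¹) * ((al * s + be) / (s + w)) + s⁻¹ * ((al * w - be) / (s + w) ^ 2), ?_, ?_⟩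
    · have e1 := hasDerivAt_inv hs0.ne'
      have e2 : HasDerivAt (fun s : ℝ => al * s + be) al s := by
        simpa using ((hasDerivAt_id s).const_mul al).add_const be
      have e3 : HasDerivAt (fun s : ℝ => s + w) 1 s := (hasDerivAt_id s).add_const w
      refine (e1.fun_mul (e2.fun_div e3 hsw.ne')).congr_deriv ?_
      field_simp
      ring
    · refine (abs_add_le _ _).trans ?_
      rw [abs_mul, abs_mul s⁻¹, abs_neg, abs_mul, abs_inv, abs_of_pos hs0]
      calc s⁻¹ * s⁻¹ * |(al * s + be) / (s + w)| + s⁻¹ * |(al * w - be) / (s + w) ^ 2|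
          ≤ s⁻¹ * s⁻¹ * l + s⁻¹ * (2 * l / s) := by gcongr
        _ = l * (3 * (1 / s)) / s := by field_simp; ring
        _ ≤ l * (1 + 3 / d) / s := by
          gcongr
          have : 3 / d = 3 * (1 / d) := by ring
          linarith

lemma H1_entry (k : ℕ) (l1 m1 m2 : ℝ) (hl : 0 < l1) (h1 : 0 < m1) (h2 : 0 < m2) (a b : Fin k) :
    ∃ al be w : ℝ, 0 ≤ w ∧ |al| ≤ l1 ∧ |be| ≤ l1 * w ∧
      ∀ s, H1mat k l1 m1 m2 s a b = s⁻¹ * ((al * s + be) / (s + w)) := by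
  have ha : ((a : ℕ) : ℝ) + 1 ≤ k := by exact_mod_cast a.2
  have hb : ((b : ℕ) : ℝ) + 1 ≤ k := by exact_mod_cast b.2
  have ha0 : (0 : ℝ) ≤ ((a : ℕ) : ℝ) := Nat.cast_nonneg _
  have hb0 : (0 : ℝ) ≤ ((b : ℕ) : ℝ) := Nat.cast_nonneg _
  by_cases hab : (a : ℕ) = (b : ℕ)
  · have p1 : 0 ≤ ((k : ℝ) - 1 - (a : ℕ)) * m2 := mul_nonneg (by linarith) h2.le
    have p2 : 0 ≤ (((a : ℕ) : ℝ) + 1) * m1 := by positivity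
    refine ⟨l1, l1 * (((k : ℝ) - 1 - (a : ℕ)) * m2),
      (((a : ℕ) : ℝ) + 1) * m1 + ((k : ℝ) - 1 - (a : ℕ)) * m2, by positivity, ?_, ?_, ?_⟩
    · rw [abs_of_pos hl]
    · rw [abs_of_nonneg (by positivity)]; gcongr; linarith
    · intro s
      simp only [H1mat, A1, Matrix.smul_apply, Matrix.of_apply, if_pos hab, smul_eq_mul]
      congr 2 <;> ring
  · by_cases hab' : (a : ℕ) + 1 = (b : ℕ)
    · have p1 : 0 ≤ ((k : ℝ) - (b : ℕ)) * m2 := mul_nonneg (by linarith) h2.le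
      have p2 : 0 ≤ ((b : ℕ) : ℝ) * m1 := by positivity
      refine ⟨0, -(l1 * (((k : ℝ) - (b : ℕ)) * m2)),
        ((b : ℕ) : ℝ) * m1 + ((k : ℝ) - (b : ℕ)) * m2, by positivity, ?_, ?_, ?_⟩
      · simpa using hl.le
      · rw [abs_neg, abs_of_nonneg (by positivity)]; gcongr; linarith
      · intro s
        simp only [H1mat, A1, Matrix.smul_apply, Matrix.of_apply, if_neg hab, if_pos hab', smul_eq_mul]
        rw [← neg_div]
        congr 2 <;> ring
    · exact ⟨0, 0, 0, le_rfl, by simpa using hl.le, by simp, fun s => by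
        simp [H1mat, A1, if_neg hab, if_neg hab']⟩

lemma H2_entry (k : ℕ) (l2 m1 m2 : ℝ) (hl : 0 < l2) (h1 : 0 < m1) (h2 : 0 < m2) (a b : Fin k) :
    ∃ al be w : ℝ, 0 ≤ w ∧ |al| ≤ l2 ∧ |be| ≤ l2 * w ∧
      ∀ s, H2mat k l2 m1 m2 s a b = s⁻¹ * ((al * s + be) / (s + w)) := by
  have ha : ((a : ℕ) : ℝ) + 1 ≤ k := by exact_mod_cast a.2
  have ha0 : (0 : ℝ) ≤ ((a : ℕ) : ℝ) := Nat.cast_nonneg _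
  have p1 : 0 ≤ ((k : ℝ) - (a : ℕ)) * m2 := mul_nonneg (by linarith) h2.le
  have p2 : 0 ≤ ((a : ℕ) : ℝ) * m1 := by positivity
  by_cases hab : (a : ℕ) = (b : ℕ)
  · refine ⟨l2, l2 * (((a : ℕ) : ℝ) * m1),
      ((a : ℕ) : ℝ) * m1 + ((k : ℝ) - (a : ℕ)) * m2, by positivity, ?_, ?_, ?_⟩
    · rw [abs_of_pos hl]
    · rw [abs_of_nonneg (by positivity)]; gcongr; linarith
    · intro s
      simp only [H2mat, A2, Matrix.smul_apply, Matrix.of_apply, if_pos hab, smul_eq_mul]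
      congr 2 <;> ring
  · by_cases hab' : (a : ℕ) = (b : ℕ) + 1
    · refine ⟨0, -(l2 * (((a : ℕ) : ℝ) * m1)),
        ((a : ℕ) : ℝ) * m1 + ((k : ℝ) - (a : ℕ)) * m2, by positivity, ?_, ?_, ?_⟩
      · simpa using hl.le
      · rw [abs_neg, abs_of_nonneg (by positivity)]; gcongr; linarith
      · intro s
        simp only [H2mat, A2, Matrix.smul_apply, Matrix.of_apply, if_neg hab, if_pos hab', smul_eq_mul]
        rw [← neg_div]
        congr 2 <;> ring
    · exact ⟨0, 0, 0, le_rfl, by simpa using hl.le, by simp, fun s => by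
        simp [H2mat, A2, if_neg hab, if_neg hab']⟩

/-- abstract fact -/
lemma mat_fact {k : ℕ} {l : ℝ} {H : ℝ → Matrix (Fin k) (Fin k) ℝ}
    (hH : ∀ a b, ∃ al be w : ℝ, 0 ≤ w ∧ |al| ≤ l ∧ |be| ≤ l * w ∧
      ∀ s, H s a b = s⁻¹ * ((al * s + be) / (s + w)))
    {d s : ℝ} (hd : 0 < d) (hs : d ≤ s) :
    Bd (H s) (l * (1 + 3 / d) / s) ∧
    Bd (Matrix.of fun a b => deriv (fun t => H t a b) s) (l * (1 + 3 / d) / s) ∧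
    MD H (Matrix.of fun a b => deriv (fun t => H t a b) s) s := by
  refine ⟨fun a b => ?_, fun a b => ?_, fun a b => ?_⟩ <;>
  · obtain ⟨al, be, w, hw, h1, h2, h3⟩ := hH a b
    obtain ⟨e1, y, hy, e2⟩ := scalar_fact hw h1 h2 hd hs
    simp only [Matrix.of_apply, h3, hy.deriv]
    assumption

lemma D_fact {k : ℕ} (B : Matrix (Fin k) (Fin k) ℝ) {d : ℝ} (hd : 0 < d) :
    ∃ N, 0 ≤ N ∧ ∀ s, d ≤ s → Bd (Dmat k B s) N ∧ Bd (Dd k B s) N ∧ MD (Dmat k B) (Dd k B s) s := by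
  have hbb : ∀ a b, |B a b| ≤ ∑ a, ∑ b, |B a b| := fun a b =>
    (Finset.single_le_sum (f := fun b => |B a b|) (fun _ _ => abs_nonneg _) (Finset.mem_univ b)).trans
    (Finset.single_le_sum (f := fun a => ∑ b, |B a b|)
      (fun _ _ => Finset.sum_nonneg fun _ _ => abs_nonneg _) (Finset.mem_univ a))
  set S := ∑ a, ∑ b, |B a b| with hS
  have hS0 : 0 ≤ S := Finset.sum_nonneg fun _ _ => Finset.sum_nonneg fun _ _ => abs_nonneg _
  refine ⟨1 + d⁻¹ * S + d⁻¹ * d⁻¹ * S, by positivity, fun s hs => ?_⟩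
  have hs0 : 0 < s := hd.trans_le hs
  have hi : s⁻¹ ≤ d⁻¹ := inv_anti₀ hd hs
  have key : ∀ a b, HasDerivAt (fun t => Dmat k B t a b) (-(s⁻¹ * s⁻¹) * B a b) s := by
    intro a b
    simp only [Dmat, Matrix.add_apply, Matrix.smul_apply, smul_eq_mul]
    have e1 := (hasDerivAt_inv hs0.ne').mul_const (B a b)
    have e2 := e1.const_add ((1 : Matrix (Fin k) (Fin k) ℝ) a b)
    refine e2.congr_deriv ?_
    rw [pow_two, mul_inv]
  refine ⟨fun a b => ?_, fun a b => ?_, fun a b => ?_⟩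
  · simp only [Dmat, Matrix.add_apply, Matrix.smul_apply, smul_eq_mul]
    have h1 : |(1 : Matrix (Fin k) (Fin k) ℝ) a b| ≤ 1 := by
      rw [Matrix.one_apply]; split_ifs <;> simp
    have h2 : |s⁻¹ * B a b| ≤ d⁻¹ * S := by
      rw [abs_mul, abs_inv, abs_of_pos hs0]
      exact mul_le_mul hi (hbb a b) (abs_nonneg _) (by positivity)
    have : 0 ≤ d⁻¹ * d⁻¹ * S := by positivity
    refine (abs_add_le _ _).trans ?_
    linarith
  · simp only [Dd, Matrix.of_apply, (key a b).deriv]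
    rw [abs_mul, abs_neg, abs_mul, abs_inv, abs_of_pos hs0]
    have : s⁻¹ * s⁻¹ * |B a b| ≤ d⁻¹ * d⁻¹ * S := by
      have := hbb a b
      gcongr
    have : 0 ≤ d⁻¹ * S := by positivity
    linarith
  · simp only [Dd, Matrix.of_apply, (key a b).deriv]
    exact key a b

/-- majorant -/
noncomputable def Fm (Y : ℝ) (i j : ℕ) : ℝ := Y ^ i / (i.factorial : ℝ) * (Y ^ j / (j.factorial : ℝ))

lemma Fm_nonneg {Y : ℝ} (hY : 0 ≤ Y) (i j : ℕ) : 0 ≤ Fm Y i j := by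
  unfold Fm; positivity

lemma Fm_left {Y : ℝ} (hY : 0 < Y) (i j : ℕ) : Fm Y i j = Fm Y (i + 1) j * ((i + 1 : ℕ) : ℝ) / Y := by
  unfold Fm
  rw [Nat.factorial_succ]
  push_cast
  field_simp
  ring

lemma Fm_right {Y : ℝ} (hY : 0 < Y) (i j : ℕ) : Fm Y i j = Fm Y i (j + 1) * ((j + 1 : ℕ) : ℝ) / Y := by
  unfold Fm
  rw [Nat.factorial_succ]
  push_cast
  field_simp
  ring

lemma Fm_summable (Y : ℝ) (hY : 0 ≤ Y) : Summable (fun q : ℕ × ℕ => Fm Y q.1 q.2) := by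
  have h := Real.summable_pow_div_factorial Y
  exact h.mul_of_nonneg h (fun i => by positivity) (fun i => by positivity)

lemma Bd.mono {k : ℕ} {P : Matrix (Fin k) (Fin k) ℝ} {m n : ℝ} (h : Bd P m) (hmn : m ≤ n) : Bd P n :=
  fun a b => (h a b).trans hmn

lemma step_left {k : ℕ} {G : ℤ → ℤ → Matrix (Fin k) (Fin k) ℝ} {P : Matrix (Fin k) (Fin k) ℝ}
    {Y r : ℝ} (hY : 0 < Y) (hr : 0 ≤ r) (i j n : ℕ) (hn : i + j = n + 1)
    (hneg : ∀ i j : ℤ, i < 0 ∨ j < 0 → G i j = 0)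
    (hG : ∀ i j : ℕ, i + j = n → Bd (G i j) (Fm Y i j))
    (hP : 0 < i → Bd P r) : Bd (P * G ((i : ℤ) - 1) j) (k * r * (Fm Y i j * i / Y)) := by
  rcases i with _ | i
  · rw [hneg _ _ (Or.inl (by simp))]
    intro a b; simp
  · have h := (hP (Nat.succ_pos i)).mul hr (hG i j (by omega))
    rw [Fm_left hY] at h
    simpa using h

lemma step_right {k : ℕ} {G : ℤ → ℤ → Matrix (Fin k) (Fin k) ℝ} {P : Matrix (Fin k) (Fin k) ℝ}
    {Y r : ℝ} (hY : 0 < Y) (hr : 0 ≤ r) (i j n : ℕ) (hn : i + j = n + 1)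
    (hneg : ∀ i j : ℤ, i < 0 ∨ j < 0 → G i j = 0)
    (hG : ∀ i j : ℕ, i + j = n → Bd (G i j) (Fm Y i j))
    (hP : 0 < j → Bd P r) : Bd (P * G i ((j : ℤ) - 1)) (k * r * (Fm Y i j * j / Y)) := by
  rcases j with _ | j
  · rw [hneg _ _ (Or.inr (by simp))]
    intro a b; simp
  · have h := (hP (Nat.succ_pos j)).mul hr (hG i j (by omega))
    rw [Fm_right hY] at h
    simpa using h

lemma dstep_left {k : ℕ} {G G' : ℤ → ℤ → ℝ → Matrix (Fin k) (Fin k) ℝ}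
    {P : ℝ → Matrix (Fin k) (Fin k) ℝ} {P' : Matrix (Fin k) (Fin k) ℝ} {s : ℝ}
    (i j n : ℕ) (hn : i + j = n + 1)
    (hneg : ∀ (i j : ℤ) (s : ℝ), i < 0 ∨ j < 0 → G i j s = 0)
    (hneg' : ∀ (i j : ℤ) (s : ℝ), i < 0 ∨ j < 0 → G' i j s = 0)
    (hG : ∀ i j : ℕ, i + j = n → MD (G i j) (G' i j s) s)
    (hP : 0 < i → MD P P' s) :
    MD (fun x => P x * G ((i : ℤ) - 1) j x)
      (P' * G ((i : ℤ) - 1) j s + P s * G' ((i : ℤ) - 1) j s) s := by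
  rcases i with _ | i
  · intro a b
    simp [hneg, hneg', hasDerivAt_const]
  · have h := (hP (Nat.succ_pos i)).mul (hG i j (by omega))
    simpa using h

lemma dstep_right {k : ℕ} {G G' : ℤ → ℤ → ℝ → Matrix (Fin k) (Fin k) ℝ}
    {P : ℝ → Matrix (Fin k) (Fin k) ℝ} {P' : Matrix (Fin k) (Fin k) ℝ} {s : ℝ}
    (i j n : ℕ) (hn : i + j = n + 1)
    (hneg : ∀ (i j : ℤ) (s : ℝ), i < 0 ∨ j < 0 → G i j s = 0)
    (hneg' : ∀ (i j : ℤ) (s : ℝ), i < 0 ∨ j < 0 → G' i j s = 0)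
    (hG : ∀ i j : ℕ, i + j = n → MD (G i j) (G' i j s) s)
    (hP : 0 < j → MD P P' s) :
    MD (fun x => P x * G i ((j : ℤ) - 1) x)
      (P' * G i ((j : ℤ) - 1) s + P s * G' i ((j : ℤ) - 1) s) s := by
  rcases j with _ | j
  · intro a b
    simp [hneg, hneg', hasDerivAt_const]
  · have h := (hP (Nat.succ_pos j)).mul (hG i j (by omega))
    simpa using h

/-- For each `s > 0`, `C(s) = Σ_{i,j≥0} D_{i,j}(s)·C_{i,j}(s)` is differentiable at `s`
(entrywise) with derivative `C'(s) = Σ_{i,j≥0} (D'_{i,j}(s)·C_{i,j}(s) + D_{i,j}(s)·C'_{i,j}(s))`;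
in particular this last series converges. -/
theorem C_differentiable
    (k : ℕ) (hk : 1 ≤ k) (l1 l2 m1 m2 t1 t2 : ℝ)
    (hl1 : 0 < l1) (hl2 : 0 < l2) (hm1 : 0 < m1) (hm2 : 0 < m2)
    (ht1 : 0 < t1) (ht2 : 0 < t2)
    (B : Matrix (Fin k) (Fin k) ℝ)
    (C C' : ℤ → ℤ → ℝ → Matrix (Fin k) (Fin k) ℝ)
    (hC00 : ∀ s : ℝ, C 0 0 s = 1)
    (hCneg : ∀ (i j : ℤ) (s : ℝ), i < 0 ∨ j < 0 → C i j s = 0)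
    (hCrec : ∀ (i j : ℤ), 0 ≤ i → 0 ≤ j → 0 < i + j → ∀ s : ℝ,
      C i j s =
        H1mat k l1 m1 m2 (s + ((i : ℝ) - 1) * t1 + (j : ℝ) * t2) * C (i - 1) j s
          + H2mat k l2 m1 m2 (s + (i : ℝ) * t1 + ((j : ℝ) - 1) * t2) * C i (j - 1) s)
    (hC'00 : ∀ s : ℝ, C' 0 0 s = 0)
    (hC'neg : ∀ (i j : ℤ) (s : ℝ), i < 0 ∨ j < 0 → C' i j s = 0)
    (hC'rec : ∀ (i j : ℤ), 0 ≤ i → 0 ≤ j → 0 < i + j → ∀ s : ℝ,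
      C' i j s =
        H1mat k l1 m1 m2 (s + ((i : ℝ) - 1) * t1 + (j : ℝ) * t2) * C' (i - 1) j s
          + H2mat k l2 m1 m2 (s + (i : ℝ) * t1 + ((j : ℝ) - 1) * t2) * C' i (j - 1) s
          + H1d k l1 m1 m2 (s + ((i : ℝ) - 1) * t1 + (j : ℝ) * t2) * C (i - 1) j s
          + H2d k l2 m1 m2 (s + (i : ℝ) * t1 + ((j : ℝ) - 1) * t2) * C i (j - 1) s) :
    ∀ s : ℝ, 0 < s → ∀ a b : Fin k,
      Summable (fun q : ℕ × ℕ =>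
        (Dd k B (s + (q.1 : ℝ) * t1 + (q.2 : ℝ) * t2) * C (q.1 : ℤ) (q.2 : ℤ) s
          + Dmat k B (s + (q.1 : ℝ) * t1 + (q.2 : ℝ) * t2) * C' (q.1 : ℤ) (q.2 : ℤ) s) a b) ∧
      HasDerivAt
        (fun t => (∑' q : ℕ × ℕ,
          Dmat k B (t + (q.1 : ℝ) * t1 + (q.2 : ℝ) * t2) * C (q.1 : ℤ) (q.2 : ℤ) t) a b)
        ((∑' q : ℕ × ℕ,
          (Dd k B (s + (q.1 : ℝ) * t1 + (q.2 : ℝ) * t2) * C (q.1 : ℤ) (q.2 : ℤ) s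
            + Dmat k B (s + (q.1 : ℝ) * t1 + (q.2 : ℝ) * t2) * C' (q.1 : ℤ) (q.2 : ℤ) s)) a b)
        s := by
  intro s hs a b
  have hd : 0 < s / 2 := by positivity
  set d := s / 2 with hdd
  set l := l1 + l2 with hl
  have hlpos : 0 < l := by positivity
  have hH1 : ∀ a b, ∃ al be w : ℝ, 0 ≤ w ∧ |al| ≤ l ∧ |be| ≤ l * w ∧
      ∀ s, H1mat k l1 m1 m2 s a b = s⁻¹ * ((al * s + be) / (s + w)) := by
    intro a b
    obtain ⟨al, be, w, hw, h1, h2, h3⟩ := H1_entry k l1 m1 m2 hl1 hm1 hm2 a b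
    exact ⟨al, be, w, hw, by linarith, by nlinarith, h3⟩
  have hH2 : ∀ a b, ∃ al be w : ℝ, 0 ≤ w ∧ |al| ≤ l ∧ |be| ≤ l * w ∧
      ∀ s, H2mat k l2 m1 m2 s a b = s⁻¹ * ((al * s + be) / (s + w)) := by
    intro a b
    obtain ⟨al, be, w, hw, h1, h2, h3⟩ := H2_entry k l2 m1 m2 hl2 hm1 hm2 a b
    exact ⟨al, be, w, hw, by linarith, by nlinarith, h3⟩
  obtain ⟨N, hN0, hN⟩ := D_fact B hd
  set M := l * (1 + 3 / d) with hM
  have hMpos : 0 < M := by positivity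
  obtain ⟨c, hc, hcd, hc1, hc2⟩ : ∃ c : ℝ, 0 < c ∧ c ≤ d ∧ c ≤ t1 ∧ c ≤ t2 :=
    ⟨min d (min t1 t2), by positivity, min_le_left _ _,
      (min_le_right _ _).trans (min_le_left _ _), (min_le_right _ _).trans (min_le_right _ _)⟩
  have hkpos : (0 : ℝ) < k := by exact_mod_cast hk
  set Y := 2 * k * M / c with hY
  have hYpos : 0 < Y := by positivity
  -- facts on the arguments
  have arg : ∀ t, d ≤ t → ∀ x y : ℝ, 0 ≤ x → 0 ≤ y →
      d ≤ t + x * t1 + y * t2 ∧ c * (x + y + 1) ≤ t + x * t1 + y * t2 := by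
    intro t ht x y hx hy
    have h1 : x * c ≤ x * t1 := by gcongr
    have h2 : y * c ≤ y * t2 := by gcongr
    have h3 : 0 ≤ x * c := by positivity
    have h4 : 0 ≤ y * c := by positivity
    constructor <;> nlinarith
  have facts1 : ∀ t, d ≤ t → ∀ i j n : ℕ, i + j = n + 1 → 0 < i →
      Bd (H1mat k l1 m1 m2 (t + ((i : ℝ) - 1) * t1 + (j : ℝ) * t2)) (M / (c * (n + 1))) ∧
      Bd (H1d k l1 m1 m2 (t + ((i : ℝ) - 1) * t1 + (j : ℝ) * t2)) (M / (c * (n + 1))) ∧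
      MD (fun x => H1mat k l1 m1 m2 (x + ((i : ℝ) - 1) * t1 + (j : ℝ) * t2))
        (H1d k l1 m1 m2 (t + ((i : ℝ) - 1) * t1 + (j : ℝ) * t2)) t := by
    intro t ht i j n hn hi
    have hi' : (1 : ℝ) ≤ i := by exact_mod_cast hi
    have hn' : (i : ℝ) + j = n + 1 := by exact_mod_cast hn
    obtain ⟨g1, g2⟩ := arg t ht ((i : ℝ) - 1) j (by linarith) (by positivity)
    have g3 : c * ((n : ℝ) + 1) ≤ t + ((i : ℝ) - 1) * t1 + (j : ℝ) * t2 := by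
      refine le_trans (le_of_eq ?_) g2
      rw [← hn']; ring
    have g4 : M / (t + ((i : ℝ) - 1) * t1 + (j : ℝ) * t2) ≤ M / (c * (n + 1)) := by
      gcongr
    obtain ⟨f1, f2, f3⟩ := mat_fact hH1 hd g1
    exact ⟨f1.mono g4, f2.mono g4, f3.shift⟩
  have facts2 : ∀ t, d ≤ t → ∀ i j n : ℕ, i + j = n + 1 → 0 < j →
      Bd (H2mat k l2 m1 m2 (t + (i : ℝ) * t1 + ((j : ℝ) - 1) * t2)) (M / (c * (n + 1))) ∧
      Bd (H2d k l2 m1 m2 (t + (i : ℝ) * t1 + ((j : ℝ) - 1) * t2)) (M / (c * (n + 1))) ∧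
      MD (fun x => H2mat k l2 m1 m2 (x + (i : ℝ) * t1 + ((j : ℝ) - 1) * t2))
        (H2d k l2 m1 m2 (t + (i : ℝ) * t1 + ((j : ℝ) - 1) * t2)) t := by
    intro t ht i j n hn hj
    have hj' : (1 : ℝ) ≤ j := by exact_mod_cast hj
    have hn' : (i : ℝ) + j = n + 1 := by exact_mod_cast hn
    obtain ⟨g1, g2⟩ := arg t ht i ((j : ℝ) - 1) (by positivity) (by linarith)
    have g3 : c * ((n : ℝ) + 1) ≤ t + (i : ℝ) * t1 + ((j : ℝ) - 1) * t2 := by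
      refine le_trans (le_of_eq ?_) g2
      rw [← hn']; ring
    have g4 : M / (t + (i : ℝ) * t1 + ((j : ℝ) - 1) * t2) ≤ M / (c * (n + 1)) := by
      gcongr
    obtain ⟨f1, f2, f3⟩ := mat_fact hH2 hd g1
    exact ⟨f1.mono g4, f2.mono g4, f3.shift⟩
  -- the main induction
  have main : ∀ t, d ≤ t → ∀ n i j : ℕ, i + j = n →
      Bd (C i j t) (Fm Y i j) ∧ Bd (C' i j t) (Fm Y i j) ∧ MD (C i j) (C' i j t) t := by
    intro t ht n
    induction n with
    | zero =>
      intro i j hij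
      obtain ⟨rfl, rfl⟩ : i = 0 ∧ j = 0 := by omega
      refine ⟨fun a b => ?_, fun a b => ?_, fun a b => ?_⟩
      · simp only [Nat.cast_zero, hC00, Matrix.one_apply, Fm]
        split_ifs <;> simp
      · simp [hC'00, Fm]
      · simp [hC'00, hC00, hasDerivAt_const]
    | succ n ih =>
      intro i j hij
      have hr : 0 ≤ M / (c * ((n : ℝ) + 1)) := by positivity
      have F1 := facts1 t ht i j n hij
      have F2 := facts2 t ht i j n hij
      have hn' : (i : ℝ) + j = n + 1 := by exact_mod_cast hij
      have hF := Fm_nonneg hYpos.le i j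
      have e : k * (M / (c * ((n : ℝ) + 1))) * (Fm Y i j * i / Y)
          + k * (M / (c * ((n : ℝ) + 1))) * (Fm Y i j * j / Y) = Fm Y i j / 2 := by
        have : k * (M / (c * ((n : ℝ) + 1))) * (Fm Y i j * i / Y)
          + k * (M / (c * ((n : ℝ) + 1))) * (Fm Y i j * j / Y)
          = k * (M / (c * ((n : ℝ) + 1))) * (Fm Y i j * ((i : ℝ) + j) / Y) := by ring
        rw [this, hn', hY]
        field_simp
      have a1 := step_left (G := fun i j => C i j t) hYpos hr i j n hij (fun i j => hCneg i j t)
        (fun i j h => (ih i j h).1) (fun h => (F1 h).1)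
      have a2 := step_right (G := fun i j => C i j t) hYpos hr i j n hij (fun i j => hCneg i j t)
        (fun i j h => (ih i j h).1) (fun h => (F2 h).1)
      have b1 := step_left (G := fun i j => C' i j t) hYpos hr i j n hij (fun i j => hC'neg i j t)
        (fun i j h => (ih i j h).2.1) (fun h => (F1 h).1)
      have b2 := step_right (G := fun i j => C' i j t) hYpos hr i j n hij (fun i j => hC'neg i j t)
        (fun i j h => (ih i j h).2.1) (fun h => (F2 h).1)
      have c1 := step_left (G := fun i j => C i j t) hYpos hr i j n hij (fun i j => hCneg i j t)
        (fun i j h => (ih i j h).1) (fun h => (F1 h).2.1)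
      have c2 := step_right (G := fun i j => C i j t) hYpos hr i j n hij (fun i j => hCneg i j t)
        (fun i j h => (ih i j h).1) (fun h => (F2 h).2.1)
      have d1 := dstep_left i j n hij hCneg hC'neg (fun i j h => (ih i j h).2.2)
        (fun h => (F1 h).2.2)
      have d2 := dstep_right i j n hij hCneg hC'neg (fun i j h => (ih i j h).2.2)
        (fun h => (F2 h).2.2)
      have rC := hCrec i j (by positivity) (by positivity) (by omega)
      have rC' := hC'rec i j (by positivity) (by positivity) (by omega)
      simp only [Int.cast_natCast] at rC rC'
      refine ⟨?_, ?_, ?_⟩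
      · rw [rC]
        exact (a1.add a2).mono (by rw [e]; linarith)
      · rw [rC']
        exact (((b1.add b2).add c1).add c2).mono (by linarith)
      · have : C i j = fun x => _ := funext rC
        rw [this, rC']
        convert d1.add d2 using 1
        abel
  -- bounds for the terms
  have term : ∀ t, d ≤ t → ∀ q : ℕ × ℕ,
      Bd (Dmat k B (t + (q.1 : ℝ) * t1 + (q.2 : ℝ) * t2) * C (q.1 : ℤ) (q.2 : ℤ) t)
        (k * N * Fm Y q.1 q.2) ∧
      Bd (Dd k B (t + (q.1 : ℝ) * t1 + (q.2 : ℝ) * t2) * C (q.1 : ℤ) (q.2 : ℤ) t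
          + Dmat k B (t + (q.1 : ℝ) * t1 + (q.2 : ℝ) * t2) * C' (q.1 : ℤ) (q.2 : ℤ) t)
        (k * N * Fm Y q.1 q.2 + k * N * Fm Y q.1 q.2) ∧
      MD (fun t => Dmat k B (t + (q.1 : ℝ) * t1 + (q.2 : ℝ) * t2) * C (q.1 : ℤ) (q.2 : ℤ) t)
        (Dd k B (t + (q.1 : ℝ) * t1 + (q.2 : ℝ) * t2) * C (q.1 : ℤ) (q.2 : ℤ) t
          + Dmat k B (t + (q.1 : ℝ) * t1 + (q.2 : ℝ) * t2) * C' (q.1 : ℤ) (q.2 : ℤ) t) t := by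
    intro t ht q
    obtain ⟨f1, f2, f3⟩ := main t ht _ q.1 q.2 rfl
    obtain ⟨g1, g2, g3⟩ := hN _ (arg t ht q.1 q.2 (by positivity) (by positivity)).1
    exact ⟨g1.mul hN0 f1, (g2.mul hN0 f1).add (g1.mul hN0 f2), g3.shift.mul f3⟩
  have sF := (Fm_summable Y hYpos.le).mul_left (k * N)
  have sF2 := sF.add sF
  have hds : d ≤ s := by rw [hdd]; linarith
  have S1 : ∀ t, d ≤ t → ∀ a b, Summable (fun q : ℕ × ℕ =>
      (Dmat k B (t + (q.1 : ℝ) * t1 + (q.2 : ℝ) * t2) * C (q.1 : ℤ) (q.2 : ℤ) t) a b) :=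
    fun t ht a b => Summable.of_norm_bounded sF fun q => (term t ht q).1 a b
  have S2 : ∀ t, d ≤ t → ∀ a b, Summable (fun q : ℕ × ℕ =>
      (Dd k B (t + (q.1 : ℝ) * t1 + (q.2 : ℝ) * t2) * C (q.1 : ℤ) (q.2 : ℤ) t
          + Dmat k B (t + (q.1 : ℝ) * t1 + (q.2 : ℝ) * t2) * C' (q.1 : ℤ) (q.2 : ℤ) t) a b) :=
    fun t ht a b => Summable.of_norm_bounded sF2 fun q => (term t ht q).2.1 a b
  have entry : ∀ f : ℕ × ℕ → Matrix (Fin k) (Fin k) ℝ, (∀ a b, Summable fun q => f q a b) →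
      (∑' q, f q) a b = ∑' q, f q a b := by
    intro f hf
    have h : HasSum f (Matrix.of fun a b => ∑' q, f q a b) :=
      Pi.hasSum.2 fun a => Pi.hasSum.2 fun b => (hf a b).hasSum
    rw [h.tsum_eq]; rfl
  refine ⟨S2 s hds a b, ?_⟩
  rw [entry _ (S2 s hds)]
  have hmem : s ∈ Set.Ioi d := by simp only [Set.mem_Ioi, hdd]; linarith
  have key := hasDerivAt_tsum_of_isPreconnected (𝕜 := ℝ) (F := ℝ) sF2 isOpen_Ioi
    (convex_Ioi d).isPreconnected
    (fun q t ht => (term t (le_of_lt ht) q).2.2 a b)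
    (fun q t ht => (term t (le_of_lt ht) q).2.1 a b) hmem (S1 s hds a b) hmem
  refine key.congr_of_eventuallyEq ?_
  filter_upwards [Ioi_mem_nhds hmem] with t ht
  exact entry _ (S1 t (le_of_lt ht))
end

section
/- For each δ > 0, the double series Σ_{i≥0} Σ_{j≥0} c_{i,j}(s) is absolutely and uniformly convergent for all s > δ; precisely, 0 ≤ c_{i,j}(s) for all i, j and s > 0, and Σ_{i≥0} Σ_{j≥0} sup_{s>δ} c_{i,j}(s) < ∞. -/
open MeasureTheory
open scoped ENNReal

/-- The Laplace–Stieltjes transform `G̃(s) = ∫ e^{-sx} dν(x)`. -/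
noncomputable def Gtil (ν : Measure ℝ) (s : ℝ) : ℝ := ∫ x, Real.exp (-s * x) ∂ν

/-- `H(s) = λ(1 - G̃(s))/s`. -/
noncomputable def Hfun (l : ℝ) (ν : Measure ℝ) (s : ℝ) : ℝ := l * (1 - Gtil ν s) / s

theorem Hfun_bounds (l : ℝ) (hl : 0 < l) (ν : Measure ℝ) [IsProbabilityMeasure ν]
    (hν : ν (Set.Iio 0) = 0) (s : ℝ) (hs : 0 < s) :
    0 ≤ Hfun l ν s ∧ Hfun l ν s ≤ l / s := by
  have h0 : 0 ≤ Gtil ν s := integral_nonneg fun x => (Real.exp_pos _).le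
  have hae : ∀ᵐ x ∂ν, 0 ≤ x := by
    rw [ae_iff]
    convert hν using 2
    ext x
    simp
  have h1 : Gtil ν s ≤ 1 := by
    have : Gtil ν s ≤ ∫ _x, (1 : ℝ) ∂ν := by
      apply integral_mono_of_nonneg
      · exact Filter.Eventually.of_forall fun x => (Real.exp_pos _).le
      · exact integrable_const _
      · filter_upwards [hae] with x hx
        apply Real.exp_le_one_iff.2
        nlinarith [mul_nonneg hs.le hx]
    simpa using this
  unfold Hfun
  constructor
  · exact div_nonneg (mul_nonneg hl.le (by linarith)) hs.le
  · gcongr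
    nlinarith

theorem exists_bound (L t δ : ℝ) (hL : 0 < L) (ht : 0 < t) (hδ : 0 < δ) :
    ∃ C : ℝ, 0 ≤ C ∧ ∀ n : ℕ,
      ∏ k ∈ Finset.range n, (2 * L / (δ + k * t)) ≤ C * (1 / 2) ^ n := by
  set b : ℕ → ℝ := fun n => ∏ k ∈ Finset.range n, (4 * L / (δ + k * t)) with hb
  have hbpos : ∀ n, 0 < b n := fun n => Finset.prod_pos fun k _ => by positivity
  have hsum : Summable b := by
    apply summable_of_ratio_test_tendsto_lt_one (l := 0) (by norm_num)
    · exact Filter.Eventually.of_forall fun n => (hbpos n).ne'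
    · have : (fun n => ‖b (n + 1)‖ / ‖b n‖) = fun n : ℕ => 4 * L / (δ + n * t) := by
        ext n
        rw [Real.norm_of_nonneg (hbpos _).le, Real.norm_of_nonneg (hbpos _).le]
        have : b (n + 1) = b n * (4 * L / (δ + n * t)) := Finset.prod_range_succ _ _
        rw [this, mul_div_cancel_left₀ _ (hbpos n).ne']
      rw [this]
      apply Filter.Tendsto.const_div_atTop
      apply Filter.tendsto_atTop_add_const_left
      exact tendsto_natCast_atTop_atTop.atTop_mul_const ht
  refine ⟨∑' n, b n, tsum_nonneg fun n => (hbpos n).le, fun n => ?_⟩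
  have h1 : b n ≤ ∑' n, b n := hsum.le_tsum n fun j _ => (hbpos j).le
  have h2 : ∏ k ∈ Finset.range n, (2 * L / (δ + k * t)) = b n * (1 / 2) ^ n := by
    have h3 : ((1 : ℝ) / 2) ^ n = ∏ _k ∈ Finset.range n, (1 / 2 : ℝ) := by simp
    rw [h3, hb, ← Finset.prod_mul_distrib]
    refine Finset.prod_congr rfl fun k _ => ?_
    ring
  rw [h2]
  gcongr

/-- For each `δ > 0`, the double series `Σ_{i,j≥0} c_{i,j}(s)` is absolutely and uniformly
convergent for `s > δ`: the terms are nonnegative and the sum over `i,j` of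
`sup_{s>δ} c_{i,j}(s)` is finite. -/
theorem cij_abs_unif_convergent
    (l1 l2 t1 t2 : ℝ) (hl1 : 0 < l1) (hl2 : 0 < l2) (ht1 : 0 < t1) (ht2 : 0 < t2)
    (ν1 ν2 : Measure ℝ) [IsProbabilityMeasure ν1] [IsProbabilityMeasure ν2]
    (hν1 : ν1 (Set.Iio 0) = 0) (hν2 : ν2 (Set.Iio 0) = 0)
    (c : ℤ → ℤ → ℝ → ℝ)
    (hc00 : ∀ s : ℝ, c 0 0 s = 1)
    (hcneg : ∀ (i j : ℤ) (s : ℝ), i < 0 ∨ j < 0 → c i j s = 0)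
    (hcrec : ∀ (i j : ℤ), 0 ≤ i → 0 ≤ j → 0 < i + j → ∀ s : ℝ,
      c i j s =
        Hfun l1 ν1 (s + ((i : ℝ) - 1) * t1 + (j : ℝ) * t2) * c (i - 1) j s
          + Hfun l2 ν2 (s + (i : ℝ) * t1 + ((j : ℝ) - 1) * t2) * c i (j - 1) s)
    (δ : ℝ) (hδ : 0 < δ) :
    (∀ (i j : ℕ) (s : ℝ), 0 < s → 0 ≤ c (i : ℤ) (j : ℤ) s) ∧
    (∑' p : ℕ × ℕ, ⨆ (s : ℝ) (_ : δ < s),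
      ENNReal.ofReal (c (p.1 : ℤ) (p.2 : ℤ) s)) < ⊤ := by
  have key : ∀ d : ℝ, 0 < d → ∀ (n : ℕ) (i j : ℕ), i + j = n → ∀ s : ℝ, d ≤ s →
      0 ≤ c i j s ∧ c i j s ≤ ∏ k ∈ Finset.range n,
        (2 * max l1 l2 / (d + k * min t1 t2)) := by
    intro d hd n
    have hL : 0 < max l1 l2 := lt_max_of_lt_left hl1
    have ht : 0 < min t1 t2 := lt_min ht1 ht2
    induction n with
    | zero =>
      intro i j hij s hs
      obtain ⟨rfl, rfl⟩ : i = 0 ∧ j = 0 := by omega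
      simp [hc00]
    | succ n ih =>
      intro i j hij s hs
      rw [Finset.prod_range_succ]
      set P := ∏ k ∈ Finset.range n, (2 * max l1 l2 / (d + k * min t1 t2)) with hP
      have hP0 : 0 ≤ P := Finset.prod_nonneg fun k _ => by positivity
      have hr := hcrec i j (by omega) (by omega) (by omega) s
      have hden : 0 < d + n * min t1 t2 := by positivity
      have hcomb : ∀ a b : ℝ, 0 ≤ a → 0 ≤ b → a + b = n →
          d + n * min t1 t2 ≤ s + a * t1 + b * t2 := by
        intro a b ha hb hab
        rw [← hab]
        nlinarith [mul_le_mul_of_nonneg_left (min_le_left t1 t2) ha,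
          mul_le_mul_of_nonneg_left (min_le_right t1 t2) hb]
      have hA : 0 ≤ Hfun l1 ν1 (s + (((i : ℤ) : ℝ) - 1) * t1 + ((j : ℤ) : ℝ) * t2)
            * c ((i : ℤ) - 1) j s ∧
          Hfun l1 ν1 (s + (((i : ℤ) : ℝ) - 1) * t1 + ((j : ℤ) : ℝ) * t2)
            * c ((i : ℤ) - 1) j s ≤ max l1 l2 / (d + n * min t1 t2) * P := by
        rcases i with _ | i
        · rw [hcneg _ _ _ (Or.inl (by simp))]
          simp only [mul_zero, le_refl, true_and]
          positivity
        · have e : (((i + 1 : ℕ) : ℤ) - 1) = (i : ℤ) := by push_cast; ring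
          have e2 : ((((i + 1 : ℕ) : ℤ) : ℝ) - 1) = (i : ℝ) := by push_cast; ring
          rw [e, e2]
          have hn : (i : ℝ) + (j : ℝ) = n := by
            have : i + j = n := by omega
            exact_mod_cast this
          obtain ⟨h1, h2⟩ := ih i j (by omega) s hs
          have hx := hcomb i j (by positivity) (by positivity) hn
          have hx0 := hden.trans_le hx
          obtain ⟨h3, h4⟩ := Hfun_bounds l1 hl1 ν1 hν1 _ hx0
          refine ⟨mul_nonneg h3 h1, mul_le_mul (h4.trans ?_) h2 h1 (by positivity)⟩
          exact div_le_div₀ hL.le (le_max_left _ _) hden hx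
      have hB : 0 ≤ Hfun l2 ν2 (s + ((i : ℤ) : ℝ) * t1 + (((j : ℤ) : ℝ) - 1) * t2)
            * c i ((j : ℤ) - 1) s ∧
          Hfun l2 ν2 (s + ((i : ℤ) : ℝ) * t1 + (((j : ℤ) : ℝ) - 1) * t2)
            * c i ((j : ℤ) - 1) s ≤ max l1 l2 / (d + n * min t1 t2) * P := by
        rcases j with _ | j
        · rw [hcneg _ _ _ (Or.inr (by simp))]
          simp only [mul_zero, le_refl, true_and]
          positivity
        · have e : (((j + 1 : ℕ) : ℤ) - 1) = (j : ℤ) := by push_cast; ring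
          have e2 : ((((j + 1 : ℕ) : ℤ) : ℝ) - 1) = (j : ℝ) := by push_cast; ring
          rw [e, e2]
          have hn : (i : ℝ) + (j : ℝ) = n := by
            have : i + j = n := by omega
            exact_mod_cast this
          obtain ⟨h1, h2⟩ := ih i j (by omega) s hs
          have hx := hcomb i j (by positivity) (by positivity) hn
          have hx0 := hden.trans_le hx
          obtain ⟨h3, h4⟩ := Hfun_bounds l2 hl2 ν2 hν2 _ hx0
          refine ⟨mul_nonneg h3 h1, mul_le_mul (h4.trans ?_) h2 h1 (by positivity)⟩
          exact div_le_div₀ hL.le (le_max_right _ _) hden hx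
      rw [hr]
      refine ⟨add_nonneg hA.1 hB.1, (add_le_add hA.2 hB.2).trans (le_of_eq ?_)⟩
      ring
  refine ⟨fun i j s hs => (key s hs _ i j rfl s le_rfl).1, ?_⟩
  obtain ⟨C, hC0, hC⟩ := exists_bound (max l1 l2) (min t1 t2) δ
    (lt_max_of_lt_left hl1) (lt_min ht1 ht2) hδ
  have hs : Summable fun p : ℕ × ℕ => C * ((1 / 2 : ℝ) ^ p.1 * (1 / 2 : ℝ) ^ p.2) :=
    (summable_geometric_two.mul_of_nonneg summable_geometric_two
      (fun n => by positivity) (fun n => by positivity)).mul_left C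
  refine lt_of_le_of_lt (ENNReal.tsum_le_tsum fun p => ?_)
    (lt_top_iff_ne_top.2 hs.tsum_ofReal_ne_top)
  refine iSup₂_le fun s hs => ENNReal.ofReal_le_ofReal ?_
  rw [← pow_add]
  exact ((key δ hδ _ p.1 p.2 rfl s hs.le).2).trans (hC _)
end

section
/- Let k ≥ 2 be an integer and λ1, λ2, μ1, μ2 > 0. Define R_1 = M_1·(λ1+λ2)^{−1} and, for 1 ≤ n ≤ k−2, assuming the (n+1)×(n+1) matrix (λ1+λ2)·I + Δ_n − R_n·Λ_{n−1} is invertible, define R_{n+1} = M_{n+1}·((λ1+λ2)·I + Δ_n − R_n·Λ_{n−1})^{−1}. Suppose row vectors p_n ∈ ℝ^{1×(n+1)} for 0 ≤ n ≤ k−1 satisfy p_0·(λ1+λ2) = p_1·M_1 and, for 1 ≤ n ≤ k−2, p_n·(λ1+λ2) + p_n·Δ_n = p_{n−1}·Λ_{n−1} + p_{n+1}·M_{n+1}. Then p_n = p_{n+1}·R_{n+1} for all 0 ≤ n ≤ k−2. -/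
open Matrix

/-- The diagonal matrix `Δ_n` with diagonal entries `i·μ1 + (n−i)·μ2`. -/
noncomputable def DeltaM (n : ℕ) (m1 m2 : ℝ) : Matrix (Fin (n + 1)) (Fin (n + 1)) ℝ :=
  Matrix.diagonal fun i => ((i : ℕ) : ℝ) * m1 + ((n : ℝ) - (i : ℕ)) * m2

/-- The arrival matrix `Λ_n`, with `Λ_n[i,i+1] = λ1` and `Λ_n[i,i] = λ2`. -/
noncomputable def LamM (n : ℕ) (l1 l2 : ℝ) : Matrix (Fin (n + 1)) (Fin (n + 2)) ℝ :=
  Matrix.of fun i j =>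
    if (i : ℕ) + 1 = (j : ℕ) then l1 else if (i : ℕ) = (j : ℕ) then l2 else 0

/-- The service matrix `M_n`, with `M_n[i,i−1] = i·μ1` and `M_n[i,i] = (n−i)·μ2`. -/
noncomputable def MM (n : ℕ) (m1 m2 : ℝ) : Matrix (Fin (n + 1)) (Fin n) ℝ :=
  Matrix.of fun i j =>
    if (i : ℕ) = (j : ℕ) + 1 then ((i : ℕ) : ℝ) * m1
    else if (i : ℕ) = (j : ℕ) then ((n : ℝ) - (i : ℕ)) * m2
    else 0

/-- The matrices `R_n`: `R_1 = M_1(λ1+λ2)⁻¹` and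
`R_{n+1} = M_{n+1}((λ1+λ2)I + Δ_n − R_nΛ_{n−1})⁻¹`. -/
noncomputable def Rmat (l1 l2 m1 m2 : ℝ) : (n : ℕ) → Matrix (Fin (n + 1)) (Fin n) ℝ
  | 0 => 0
  | 1 => (l1 + l2)⁻¹ • MM 1 m1 m2
  | n + 2 =>
      MM (n + 2) m1 m2 *
        ((l1 + l2) • (1 : Matrix (Fin (n + 2)) (Fin (n + 2)) ℝ) + DeltaM (n + 1) m1 m2
          - Rmat l1 l2 m1 m2 (n + 1) * LamM n l1 l2)⁻¹

/-- If the row vectors `p_0, …, p_{k−1}` satisfy the balance equations, then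
`p_n = p_{n+1}·R_{n+1}` for `0 ≤ n ≤ k−2`. -/
theorem pn_eq_pn1_Rn1
    (k : ℕ) (hk : 2 ≤ k) (l1 l2 m1 m2 : ℝ)
    (hl1 : 0 < l1) (hl2 : 0 < l2) (hm1 : 0 < m1) (hm2 : 0 < m2)
    (hinv : ∀ n : ℕ, n + 3 ≤ k →
      IsUnit ((l1 + l2) • (1 : Matrix (Fin (n + 2)) (Fin (n + 2)) ℝ) + DeltaM (n + 1) m1 m2
        - Rmat l1 l2 m1 m2 (n + 1) * LamM n l1 l2).det)
    (p : (n : ℕ) → Fin (n + 1) → ℝ)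
    (hp0 : (l1 + l2) • p 0 = p 1 ᵥ* MM 1 m1 m2)
    (hbal : ∀ n : ℕ, n + 3 ≤ k →
      (l1 + l2) • p (n + 1) + p (n + 1) ᵥ* DeltaM (n + 1) m1 m2
        = p n ᵥ* LamM n l1 l2 + p (n + 2) ᵥ* MM (n + 2) m1 m2) :
    ∀ n : ℕ, n + 2 ≤ k → p n = p (n + 1) ᵥ* Rmat l1 l2 m1 m2 (n + 1) := by
  intro n
  induction n with
  | zero =>
    intro _
    have h : l1 + l2 ≠ 0 := by positivity
    change p 0 = p 1 ᵥ* Rmat l1 l2 m1 m2 1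
    rw [Rmat, Matrix.vecMul_smul, ← hp0, smul_smul, inv_mul_cancel₀ h, one_smul]
  | succ n ih =>
    intro hn
    have h1 := ih (by omega)
    have h2 := hbal n (by omega)
    have h3 := hinv n (by omega)
    change p (n + 1) = p (n + 2) ᵥ* Rmat l1 l2 m1 m2 (n + 2)
    rw [Rmat, ← Matrix.vecMul_vecMul]
    have h4 : p (n + 2) ᵥ* MM (n + 2) m1 m2 = p (n + 1) ᵥ*
        ((l1 + l2) • (1 : Matrix (Fin (n + 2)) (Fin (n + 2)) ℝ) + DeltaM (n + 1) m1 m2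
          - Rmat l1 l2 m1 m2 (n + 1) * LamM n l1 l2) := by
      rw [Matrix.vecMul_sub, Matrix.vecMul_add, Matrix.vecMul_smul, Matrix.vecMul_one,
        ← Matrix.vecMul_vecMul, ← h1, h2, add_sub_cancel_left]
    rw [h4, Matrix.vecMul_vecMul, Matrix.mul_nonsing_inv _ h3, Matrix.vecMul_one]
end

section
/- Let W and T be random variables on a probability space such that W ≥ 0 almost surely, T has the exponential distribution with rate θ > 0, and W and T are independent. Then min(W,T) is integrable and E[min(W,T)] = (1 − E[exp(−θ·W)])/θ. -/
open MeasureTheory ProbabilityTheory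

lemma aux_tail (θ : ℝ) (hθ : 0 < θ) (s : ℝ) (hs : 0 ≤ s) :
    expMeasure θ (Set.Ioi s) = ENNReal.ofReal (Real.exp (-(θ * s))) := by
  haveI := isProbabilityMeasure_expMeasure hθ
  have h := cdf_expMeasure_eq hθ s
  rw [if_pos hs, cdf_eq_real] at h
  have h2 : (expMeasure θ).real (Set.Ioi s) = Real.exp (-(θ * s)) := by
    rw [← Set.compl_Iic, probReal_compl_eq_one_sub measurableSet_Iic, h]
    ring
  rw [← h2, ofReal_measureReal]

lemma aux_int (θ : ℝ) (hθ : 0 < θ) (w : ℝ) (hw : 0 ≤ w) :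
    ∫⁻ s in Set.Ioo 0 w, ENNReal.ofReal (Real.exp (-(θ * s)))
      = ENNReal.ofReal ((1 - Real.exp (-(θ * w))) / θ) := by
  have hc : Continuous fun s : ℝ => Real.exp (-(θ * s)) := by fun_prop
  rw [← ofReal_integral_eq_lintegral_ofReal]
  · congr 1
    rw [← integral_Ioc_eq_integral_Ioo, ← intervalIntegral.integral_of_le hw]
    have hd : ∀ x ∈ Set.uIcc 0 w,
        HasDerivAt (fun a => -Real.exp (-(θ * a)) / θ) (Real.exp (-(θ * x))) x := by
      intro x _
      have := (hasDerivAt_neg_exp_mul_exp (r := θ) (x := x)).div_const θ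
      rwa [mul_div_cancel_left₀ _ hθ.ne'] at this
    rw [intervalIntegral.integral_eq_sub_of_hasDerivAt hd (hc.intervalIntegrable _ _)]
    simp
    ring
  · exact (hc.integrableOn_Icc (a := 0) (b := w)).mono_set Set.Ioo_subset_Icc_self
  · exact Filter.Eventually.of_forall fun _ => (Real.exp_pos _).le

lemma aux_key (θ : ℝ) (hθ : 0 < θ) (w : ℝ) (hw : 0 ≤ w) :
    ∫⁻ t, ENNReal.ofReal (min w t) ∂(expMeasure θ)
      = ENNReal.ofReal ((1 - Real.exp (-(θ * w))) / θ) := by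
  have h1 : ∀ t : ℝ, ENNReal.ofReal (min w t) = ENNReal.ofReal (max 0 (min w t)) := by
    intro t
    rw [ENNReal.ofReal_max]; simp
  simp_rw [h1]
  rw [lintegral_eq_lintegral_meas_lt (f := fun t => max 0 (min w t)) _ (Filter.Eventually.of_forall fun t => le_max_left _ _)
    (by fun_prop), ← aux_int θ hθ w hw, ← lintegral_indicator measurableSet_Ioi,
    ← lintegral_indicator measurableSet_Ioo]
  congr 1
  ext s
  by_cases hs : 0 < s
  · by_cases hsw : s < w
    · rw [Set.indicator_of_mem (Set.mem_Ioi.2 hs), Set.indicator_of_mem (Set.mem_Ioo.2 ⟨hs, hsw⟩),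
        ← aux_tail θ hθ s hs.le]
      congr 1
      ext t
      simp [hs.not_gt, hsw]
    · rw [Set.indicator_of_mem (Set.mem_Ioi.2 hs), Set.indicator_of_notMem (fun h => hsw h.2)]
      have : {a | s < max 0 (min w a)} = (∅ : Set ℝ) := by
        ext t
        simp [hs.not_gt, hsw]
      rw [this, measure_empty]
  · rw [Set.indicator_of_notMem (by simpa using hs), Set.indicator_of_notMem (fun h => hs h.1)]

/-- If `W ≥ 0` a.s., `T` is exponential with rate `θ`, and `W` and `T` are independent,
then `min(W,T)` is integrable and `E[min(W,T)] = (1 − E[exp(−θW)])/θ`. -/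
theorem expectation_min_W_T
    {Ω : Type*} [MeasurableSpace Ω] (μ : Measure Ω) [IsProbabilityMeasure μ]
    (W T : Ω → ℝ) (hWm : Measurable W) (hTm : Measurable T)
    (hW : ∀ᵐ ω ∂μ, 0 ≤ W ω) (θ : ℝ) (hθ : 0 < θ)
    (hT : μ.map T = expMeasure θ)
    (hindep : IndepFun W T μ) :
    Integrable (fun ω => min (W ω) (T ω)) μ ∧
    ∫ ω, min (W ω) (T ω) ∂μ = (1 - ∫ ω, Real.exp (-(θ * W ω)) ∂μ) / θ := by
  haveI := isProbabilityMeasure_expMeasure hθ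
  have hprod := (indepFun_iff_map_prod_eq_prod_map_map hWm.aemeasurable hTm.aemeasurable).1 hindep
  rw [hT] at hprod
  have hT0 : ∀ᵐ ω ∂μ, 0 ≤ T ω := by
    have h0 : ∀ᵐ t ∂(μ.map T), t ∈ Set.Ioi (0 : ℝ) := by
      rw [hT]
      refine (mem_ae_iff_prob_eq_one measurableSet_Ioi).2 ?_
      rw [aux_tail θ hθ 0 le_rfl]
      simp
    filter_upwards [ae_of_ae_map hTm.aemeasurable h0] with ω h
    exact le_of_lt h
  have hmin : 0 ≤ᵐ[μ] fun ω => min (W ω) (T ω) := by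
    filter_upwards [hW, hT0] with ω h1 h2
    exact le_min h1 h2
  have hexp : Integrable (fun ω => Real.exp (-(θ * W ω))) μ := by
    refine Integrable.of_bound (by fun_prop) 1 ?_
    filter_upwards [hW] with ω h
    rw [Real.norm_eq_abs, abs_of_pos (Real.exp_pos _), Real.exp_le_one_iff]
    have := mul_nonneg hθ.le h
    linarith
  have hg : Integrable (fun ω => (1 - Real.exp (-(θ * W ω))) / θ) μ :=
    ((integrable_const 1).sub hexp).div_const θ
  have hg0 : 0 ≤ᵐ[μ] fun ω => (1 - Real.exp (-(θ * W ω))) / θ := by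
    filter_upwards [hW] with ω h
    have := mul_nonneg hθ.le h
    have h2 : Real.exp (-(θ * W ω)) ≤ 1 := Real.exp_le_one_iff.2 (by linarith)
    exact div_nonneg (by linarith) hθ.le
  have hmm : Measurable fun p : ℝ × ℝ => ENNReal.ofReal (min p.1 p.2) := by fun_prop
  have key : ∫⁻ ω, ENNReal.ofReal (min (W ω) (T ω)) ∂μ
      = ∫⁻ ω, ENNReal.ofReal ((1 - Real.exp (-(θ * W ω))) / θ) ∂μ := by
    have e1 : ∫⁻ ω, ENNReal.ofReal (min (W ω) (T ω)) ∂μ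
        = ∫⁻ p, ENNReal.ofReal (min p.1 p.2) ∂(μ.map fun ω => (W ω, T ω)) := by
      rw [lintegral_map hmm (hWm.prodMk hTm)]
    rw [e1, hprod, lintegral_prod _ hmm.aemeasurable,
      lintegral_map hmm.lintegral_prod_right' hWm]
    refine lintegral_congr_ae ?_
    filter_upwards [hW] with ω h
    exact aux_key θ hθ _ h
  have hms : AEStronglyMeasurable (fun ω => min (W ω) (T ω)) μ :=
    (hWm.min hTm).aestronglyMeasurable
  refine ⟨⟨hms, ?_⟩, ?_⟩
  · rw [hasFiniteIntegral_iff_ofReal hmin, key]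
    exact (hasFiniteIntegral_iff_ofReal hg0).1 hg.2
  · rw [integral_eq_lintegral_of_nonneg_ae hmin hms, key,
      ← integral_eq_lintegral_of_nonneg_ae hg0 hg.1, integral_div,
      integral_sub (integrable_const 1) hexp]
    simp
end
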